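/- arXiv:2509.08762 — 5 statements merged into one kernel-verified Lean document; each statement's English description precedes it below -/
import Mathlib

section
/- Let d, ℓ ≥ 2 be integers, let G be a finite simple graph no subgraph of which is an (ℓ−1)-subdivision of the uniform binary tree H_d, and let Z ⊆ V(G). Then there exists Y ⊇ Z with the following properties: (i) every vertex in Y has distance at most (d−2)(ℓ−1) in G from Z; and (ii) there is no path P of G of length at least two and at most ℓ such that the ends u, v of P belong to Y, the interior of P is disjoint from Y, and dist_{G[Y]}(u,v) > 2(d−2)(ℓ−1). -/
open SimpleGraph

/-- The distance in a graph `G` between two sets of vertices (`⊤` if no connecting walk). -/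
noncomputable def eSetDist {V : Type*} (G : SimpleGraph V) (A B : Set V) : ℕ∞ :=
  sInf {n : ℕ∞ | ∃ (a b : V) (w : G.Walk a b), a ∈ A ∧ b ∈ B ∧ (w.length : ℕ∞) = n}

/-- The uniform binary tree of depth `d`: vertices are binary strings of length `< d`
(the root is the empty string), and each string is adjacent to its two one-letter
extensions.  For `d ≥ 2` this is exactly the tree `H_d` with a root of degree two, all
other vertices of degree one or three, and all leaves at distance `d-1` from the root. -/
def binTree (d : ℕ) : SimpleGraph {l : List Bool // l.length < d} :=
  SimpleGraph.fromRel (fun a b => ∃ x : Bool, (b : List Bool) = x :: (a : List Bool))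

/-- `G` contains an `n`-subdivision of `H` as a subgraph: there is an injection `f` of the
vertices of `H` into `G` and, for each edge `ab` of `H`, a path of `G` from `f a` to `f b`
of length at least one and at most `n`, these paths being pairwise vertex-disjoint except
for their ends (branch vertices). -/
def HasNSubdivision {V W : Type*} (G : SimpleGraph V) (H : SimpleGraph W) (n : ℕ) : Prop :=
  ∃ (f : W → V) (P : ∀ ⦃a b : W⦄, H.Adj a b → G.Walk (f a) (f b)),
    Function.Injective f ∧
    (∀ a b (h : H.Adj a b), (P h).IsPath) ∧
    (∀ a b (h : H.Adj a b), 1 ≤ (P h).length ∧ (P h).length ≤ n) ∧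
    (∀ a b (h : H.Adj a b), ∀ x ∈ (P h).support, x ∈ Set.range f → x = f a ∨ x = f b) ∧
    (∀ a b a' b' (h : H.Adj a b) (h' : H.Adj a' b'), s(a, b) ≠ s(a', b') →
      ∀ x ∈ (P h).support, x ∈ (P h').support → x ∈ Set.range f)

/-- The subgraph of `G` induced on the vertex set `Y`, kept as a graph on the same vertex
type (vertices outside `Y` become isolated).  Distances between vertices of `Y` in this
graph agree with distances in the induced subgraph `G[Y]`. -/
def inducedSG {V : Type*} (G : SimpleGraph V) (Y : Set V) : SimpleGraph V where
  Adj a b := G.Adj a b ∧ a ∈ Y ∧ b ∈ Y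
  symm := ⟨fun a b ⟨h, ha, hb⟩ => ⟨h.symm, hb, ha⟩⟩
  loopless := ⟨fun a ⟨h, _, _⟩ => G.loopless.irrefl a h⟩

/-- Rooted `n`-subdivisions of the binary tree with `k+1` levels, with their vertex set. -/
inductive RTree {V : Type} (G : SimpleGraph V) (n : ℕ) : ℕ → V → Set V → Prop
  | leaf (r : V) : RTree G n 0 r {r}
  | node (k : ℕ) (r : V) (c : Bool → V) (A : Bool → Set V) (p : ∀ x, G.Walk r (c x))
      (hA : ∀ x, RTree G n k (c x) (A x))
      (hp : ∀ x, (p x).IsPath)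
      (h1 : ∀ x, 1 ≤ (p x).length)
      (hn : ∀ x, (p x).length ≤ n)
      (hpA : ∀ x, ∀ z ∈ (p x).support, z ∈ A x → z = c x)
      (hpA' : ∀ x y, x ≠ y → ∀ z ∈ (p x).support, z ∉ A y)
      (hAA : ∀ x y, x ≠ y → ∀ z ∈ A x, z ∉ A y)
      (hpp : ∀ x y, x ≠ y → ∀ z ∈ (p x).support, z ∈ (p y).support → z = r) :
      RTree G n (k + 1) r {z | ∃ x, z ∈ A x ∨ z ∈ (p x).support}

theorem RTree.root_mem {V : Type} {G : SimpleGraph V} {n k : ℕ} {r : V} {S : Set V}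
    (h : RTree G n k r S) : r ∈ S := by
  cases h with
  | leaf => simp
  | node k c A p hA => exact ⟨true, Or.inr (by simp)⟩

theorem RTree.pred {V : Type} {G : SimpleGraph V} {n k : ℕ} {r : V} {S : Set V}
    (h : RTree G n k r S) : ∀ j, j + 1 = k → ∃ S' ⊆ S, RTree G n j r S' := by
  induction h with
  | leaf r => intro j hj; omega
  | node k r c A p hA hp h1 hn hpA hpA' hAA hpp ih =>
    intro j hj
    obtain rfl : j = k := by omega
    cases j with
    | zero =>
      refine ⟨{r}, ?_, RTree.leaf r⟩
      rintro z rfl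
      exact ⟨true, Or.inr (by simp)⟩
    | succ j =>
      choose A' hsub hA' using fun x => ih x j rfl
      refine ⟨_, ?_, RTree.node j r c A' p hA' hp h1 hn (fun x z hz hz' => hpA x z hz (hsub x hz'))
        (fun x y hxy z hz hz' => hpA' x y hxy z hz (hsub y hz'))
        (fun x y hxy z hz hz' => hAA x y hxy z (hsub x hz) (hsub y hz')) hpp⟩
      rintro z ⟨x, hz | hz⟩
      · exact ⟨x, Or.inl (hsub x hz)⟩
      · exact ⟨x, Or.inr hz⟩

theorem RTree.trunc {V : Type} {G : SimpleGraph V} {n k : ℕ} {r : V} {S : Set V}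
    (h : RTree G n k r S) {j : ℕ} (hj : j ≤ k) : ∃ S' ⊆ S, RTree G n j r S' := by
  induction k generalizing S with
  | zero =>
    obtain rfl : j = 0 := by omega
    exact ⟨S, subset_rfl, h⟩
  | succ k ih =>
    rcases Nat.lt_or_ge k j with h' | h'
    · obtain rfl : j = k + 1 := by omega
      exact ⟨S, subset_rfl, h⟩
    · obtain ⟨S', hS', hT⟩ := h.pred k rfl
      obtain ⟨S'', hS'', hT'⟩ := ih hT h'
      exact ⟨S'', hS''.trans hS', hT'⟩

theorem walk_induced {V : Type} {G : SimpleGraph V} {Y : Set V} {a b : V} (w : G.Walk a b)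
    (hw : ∀ z ∈ w.support, z ∈ Y) :
    ∃ w' : (inducedSG G Y).Walk a b, w'.length = w.length := by
  induction w with
  | nil => exact ⟨Walk.nil, rfl⟩
  | @cons a b c h w ih =>
    obtain ⟨w', hw'⟩ := ih (fun z hz => hw z (by simp [hz]))
    have hadj : (inducedSG G Y).Adj a b := ⟨h, hw _ (by simp), hw _ (by simp)⟩
    exact ⟨Walk.cons hadj w', by rw [Walk.length_cons, Walk.length_cons, hw']⟩

theorem RTree.radius {V : Type} {G : SimpleGraph V} {n k : ℕ} {r : V} {S : Set V}
    (h : RTree G n k r S) {Y : Set V} (hS : S ⊆ Y) :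
    ∀ z ∈ S, ∃ w : (inducedSG G Y).Walk r z, w.length ≤ k * n := by
  classical
  induction h with
  | leaf r => rintro z rfl; exact ⟨Walk.nil, by simp⟩
  | node k r c A p hA hp h1 hn hpA hpA' hAA hpp ih =>
    rintro z ⟨x, hz | hz⟩
    · obtain ⟨w, hw⟩ := ih x (fun y hy => hS ⟨x, Or.inl hy⟩) z hz
      obtain ⟨q, hq⟩ := walk_induced (Y := Y) (p x) (fun y hy => hS ⟨x, Or.inr hy⟩)
      refine ⟨q.append w, ?_⟩
      have := hn x
      rw [Walk.length_append, hq, add_mul]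
      omega
    · obtain ⟨q, hq⟩ := walk_induced (Y := Y) ((p x).takeUntil z hz)
        (fun y hy => hS ⟨x, Or.inr ((p x).support_takeUntil_subset_support hz hy)⟩)
      refine ⟨q, ?_⟩
      have := hn x
      have := (p x).length_takeUntil_le_length hz
      rw [hq, add_mul]
      omega

theorem RTree.embed {V : Type} {G : SimpleGraph V} {n k : ℕ} {r : V} {S : Set V}
    (h : RTree G n k r S) : ∃ (g : List Bool → V) (E : List Bool → Set V),
      g [] = r ∧ (∀ l, l.length ≤ k → g l ∈ S) ∧
      (∀ l m, l.length ≤ k → m.length ≤ k → g l = g m → l = m) ∧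
      (∀ l x, l.length < k → ∃ p : G.Walk (g l) (g (l ++ [x])), p.IsPath ∧ 1 ≤ p.length ∧
        p.length ≤ n ∧ ∀ z ∈ p.support, z ∈ E (l ++ [x])) ∧
      (∀ l, l ≠ [] → l.length ≤ k → E l ⊆ S) ∧
      (∀ l m, l ≠ [] → l.length ≤ k → m.length ≤ k → g m ∈ E l → m = l ∨ m = l.dropLast) ∧
      (∀ l m, l ≠ [] → m ≠ [] → l.length ≤ k → m.length ≤ k → l ≠ m → ∀ z ∈ E l, z ∈ E m →
        ∃ j, j.length ≤ k ∧ z = g j) := by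
  induction h with
  | leaf r =>
    refine ⟨fun _ => r, fun _ => ∅, rfl, by simp, ?_, by simp, by simp, by simp, by simp⟩
    intro l m hl hm _
    simp at hl hm
    rw [hl, hm]
  | node k r c A p hA hp h1 hn hpA hpA' hAA hpp ih =>
    choose g E hg0 hgS hinj hw hES hgE hEE using ih
    have hrA : ∀ x, r ∉ A x := fun x => hpA' (!x) x (by simp) r (by simp)
    have hAx : ∀ x y z, z ∈ A x → z ∈ A y → x = y := fun x y z h h' => by
      by_contra hxy
      exact hAA x y hxy z h h'
    have hpAx : ∀ x y z, z ∈ (p x).support → z ∈ A y → x = y := fun x y z h h' => by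
      by_contra hxy
      exact hpA' x y hxy z h h'
    let g' : List Bool → V := fun l => match l with
      | [] => r
      | x :: l => g x l
    let E' : List Bool → Set V := fun l => match l with
      | [] => ∅
      | [x] => {z | z ∈ (p x).support}
      | x :: y :: l => E x (y :: l)
    refine ⟨g', E', rfl, ?_, ?_, ?_, ?_, ?_, ?_⟩
    · rintro (_ | ⟨x, l⟩) hl
      · exact ⟨true, Or.inr (by simp [g'])⟩
      · exact ⟨x, Or.inl (hgS x l (by simpa using hl))⟩
    · rintro (_ | ⟨x, l⟩) (_ | ⟨y, m⟩) hl hm heq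
      · rfl
      · exact absurd (heq ▸ hgS y m (by simpa using hm) : g' [] ∈ A y) (hrA y)
      · exact absurd (heq ▸ hgS x l (by simpa using hl) : g' [] ∈ A x) (hrA x)
      · have heq' : g x l = g y m := heq
        have h2 := hgS y m (by simpa using hm)
        rw [← heq'] at h2
        obtain rfl := hAx x y _ (hgS x l (by simpa using hl)) h2
        rw [hinj x l m (by simpa using hl) (by simpa using hm) heq']
    · rintro (_ | ⟨y, l⟩) x hl
      · have e : c x = g' ([] ++ [x]) := (hg0 x).symm
        refine ⟨(p x).copy rfl e, ?_, ?_, ?_, ?_⟩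
        · simpa using hp x
        · simpa using h1 x
        · simpa using hn x
        · intro z hz
          simpa [E'] using hz
      · obtain ⟨q, hq⟩ := hw y l x (by simpa using hl)
        refine ⟨q, hq.1, hq.2.1, hq.2.2.1, ?_⟩
        intro z hz
        have := hq.2.2.2 z hz
        cases l with
        | nil => exact this
        | cons a l => exact this
    · rintro (_ | ⟨x, _ | ⟨y, l⟩⟩) h0 hl z hz
      · exact absurd rfl h0
      · exact ⟨x, Or.inr hz⟩
      · exact ⟨x, Or.inl (hES x _ (by simp) (by simpa using hl) hz)⟩
    · rintro (_ | ⟨x, _ | ⟨y, l⟩⟩) (_ | ⟨u, m⟩) h0 hl hm hz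
      · exact absurd rfl h0
      · exact absurd rfl h0
      · right; rfl
      · left
        have h2 := hgS u m (by simpa using hm)
        obtain rfl := hpAx x u _ hz h2
        have h3 := hpA x _ hz h2
        have h4 : g x m = g x [] := h3.trans (hg0 x).symm
        rw [hinj x m [] (by simpa using hm) (by simp) h4]
      · exact absurd (hES x _ (by simp) (by simpa using hl) hz) (hrA x)
      · have h2 := hgS u m (by simpa using hm)
        obtain rfl := hAx x u _ (hES x _ (by simp) (by simpa using hl) hz) h2
        rcases hgE x (y :: l) m (by simp) (by simpa using hl) (by simpa using hm) hz with h | h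
        · left; rw [h]
        · right; rw [h]; rfl
    · rintro (_ | ⟨x, _ | ⟨y, l⟩⟩) (_ | ⟨u, _ | ⟨v, m⟩⟩) h0 h0' hl hm hlm z hz hz'
      · exact absurd rfl h0
      · exact absurd rfl h0
      · exact absurd rfl h0
      · exact absurd rfl h0'
      · exact ⟨[], by simp, hpp x u (by rintro rfl; exact hlm rfl) z hz hz'⟩
      · have h2 := hES u _ (by simp) (by simpa using hm) hz'
        obtain rfl := hpAx x u _ hz h2
        exact ⟨[x], by simp, (hpA x z hz h2).trans (hg0 x).symm⟩
      · exact absurd rfl h0'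
      · have h2 := hES x _ (by simp) (by simpa using hl) hz
        obtain rfl := hpAx u x _ hz' h2
        exact ⟨[u], by simp, (hpA u z hz' h2).trans (hg0 u).symm⟩
      · have h2 := hES x _ (by simp) (by simpa using hl) hz
        have h3 := hES u _ (by simp) (by simpa using hm) hz'
        obtain rfl := hAx x u _ h2 h3
        obtain ⟨j, hj, hj'⟩ := hEE x (y :: l) (v :: m) (by simp) (by simp) (by simpa using hl)
          (by simpa using hm) (by rintro h; exact hlm (by rw [h])) z hz hz'
        exact ⟨x :: j, by simpa using hj, hj'⟩

theorem RTree.hasNSubdivision {V : Type} {G : SimpleGraph V} {n d : ℕ} (hd : 1 ≤ d) {r : V}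
    {S : Set V} (h : RTree G n (d - 1) r S) : HasNSubdivision G (binTree d) n := by
  obtain ⟨g, E, -, -, hinj, hw, -, hgE, hEE⟩ := h.embed
  let W := {l : List Bool // l.length < d}
  let f : W → V := fun a => g a.1.reverse
  let el : W → W → W := fun a b => if a.1.length < b.1.length then b else a
  have hlen : ∀ a : W, a.1.reverse.length ≤ d - 1 := fun a => by
    have := a.2
    simp only [List.length_reverse]
    omega
  have key : ∀ a b : W, (binTree d).Adj a b →
      ((el a b).1 ≠ [] ∧ s(a, b) = s(el a b, ⟨(el a b).1.tail, by
        have := (el a b).2; simp only [List.length_tail]; omega⟩)) := by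
    rintro ⟨a, ha⟩ ⟨b, hb⟩ h
    simp only [binTree, SimpleGraph.fromRel_adj] at h
    obtain ⟨-, ⟨x, hx⟩ | ⟨x, hx⟩⟩ := h
    · subst hx
      have he : el ⟨a, ha⟩ ⟨x :: a, hb⟩ = ⟨x :: a, hb⟩ := if_pos (by simp)
      simp only [he]
      exact ⟨by simp, Sym2.eq_swap⟩
    · subst hx
      have he : el ⟨x :: b, ha⟩ ⟨b, hb⟩ = ⟨x :: b, ha⟩ := if_neg (by simp)
      simp only [he]
      exact ⟨by simp, rfl⟩
  have hP : ∀ (a b : W) (h : (binTree d).Adj a b), ∃ p : G.Walk (f a) (f b), p.IsPath ∧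
      1 ≤ p.length ∧ p.length ≤ n ∧ ∀ z ∈ p.support, z ∈ E (el a b).1.reverse := by
    rintro ⟨a, ha⟩ ⟨b, hb⟩ h
    simp only [binTree, SimpleGraph.fromRel_adj] at h
    obtain ⟨-, ⟨x, hx⟩ | ⟨x, hx⟩⟩ := h
    · subst hx
      obtain ⟨p, h1, h2, h3, h4⟩ := hw a.reverse x (by simp at hb ⊢; omega)
      refine ⟨p.copy rfl (by simp [f]), by simpa using h1, by simpa using h2, by simpa using h3, ?_⟩
      simpa [el] using h4
    · subst hx
      obtain ⟨p, h1, h2, h3, h4⟩ := hw b.reverse x (by simp at ha ⊢; omega)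
      refine ⟨(p.copy rfl (by simp [f])).reverse, by simpa using h1, by simpa using h2,
        by simpa using h3, ?_⟩
      simpa [el] using h4
  choose P hP1 hP2 hP3 hP4 using hP
  refine ⟨f, P, ?_, hP1, fun a b h => ⟨hP2 a b h, hP3 a b h⟩, ?_, ?_⟩
  · intro a b hab
    exact Subtype.ext (List.reverse_injective (hinj _ _ (hlen a) (hlen b) hab))
  · rintro a b h x hx ⟨m, rfl⟩
    obtain ⟨hne, hs⟩ := key a b h
    have h2 := hgE _ m.1.reverse (by simpa using hne) (hlen (el a b)) (hlen m) (hP4 a b h _ hx)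
    have h3 : m ∈ s(a, b) := by
      rw [hs, Sym2.mem_iff]
      rcases h2 with h2 | h2
      · left; exact Subtype.ext (List.reverse_injective h2)
      · right
        rw [List.dropLast_reverse] at h2
        exact Subtype.ext (List.reverse_injective h2)
    rw [Sym2.mem_iff] at h3
    rcases h3 with rfl | rfl
    · left; rfl
    · right; rfl
  · intro a b a' b' h h' hne x hx hx'
    obtain ⟨h1, hs⟩ := key a b h
    obtain ⟨h1', hs'⟩ := key a' b' h'
    have hel : (el a b).1.reverse ≠ (el a' b').1.reverse := by
      intro he
      have he' : el a b = el a' b' := Subtype.ext (List.reverse_injective he)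
      apply hne
      rw [hs, hs']
      simp only [he']
    obtain ⟨j, hj, rfl⟩ := hEE _ _ (by simpa using h1) (by simpa using h1') (hlen _) (hlen _) hel x
      (hP4 a b h x hx) (hP4 a' b' h' x hx')
    exact ⟨⟨j.reverse, by simp; omega⟩, by simp [f]⟩

theorem eSetDist_le {V : Type} {G : SimpleGraph V} {A B : Set V} {a b : V} (w : G.Walk a b)
    (ha : a ∈ A) (hb : b ∈ B) {N : ℕ} (hN : w.length ≤ N) : eSetDist G A B ≤ (N : ℕ∞) := by
  have h : eSetDist G A B ≤ (w.length : ℕ∞) := sInf_le ⟨a, b, w, ha, hb, rfl⟩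
  exact h.trans (by exact_mod_cast hN)

theorem RTree.step {V : Type} {G : SimpleGraph V} {n k : ℕ} {u v q : V} {A B Y : Set V}
    (hA : RTree G n k u A) (hB : RTree G n k v B) (hAY : A ⊆ Y) (hBY : B ⊆ Y)
    (hAB : ∀ z ∈ A, z ∉ B) (P : G.Walk u v) (hP : P.IsPath) (hn : P.length ≤ n + 1)
    (hint : ∀ x ∈ P.support, x ≠ u → x ≠ v → x ∉ Y) (hq : q ∈ P.support) (hqY : q ∉ Y) :
    ∃ S ⊆ Y ∪ {z | z ∈ P.support}, RTree G n (k + 1) q S ∧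
      (∃ w : G.Walk q u, w.length ≤ n) ∧ ∃ w : G.Walk q v, w.length ≤ n := by
  classical
  have huA := hA.root_mem
  have hvB := hB.root_mem
  have hqu : q ≠ u := by rintro rfl; exact hqY (hAY huA)
  have hqv : q ≠ v := by rintro rfl; exact hqY (hBY hvB)
  let p1 : G.Walk q u := (P.takeUntil q hq).reverse
  let p2 : G.Walk q v := P.dropUntil q hq
  have hlen : p1.length + p2.length = P.length := by
    have := congrArg Walk.length (P.take_spec hq)
    rw [Walk.length_append] at this
    simpa only [p1, p2, Walk.length_reverse] using this
  have hl1 : 1 ≤ p1.length := by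
    by_contra h
    exact hqu (Walk.eq_of_length_eq_zero (p := p1) (by omega))
  have hl2 : 1 ≤ p2.length := by
    by_contra h
    exact hqv (Walk.eq_of_length_eq_zero (p := p2) (by omega))
  have hs1 : ∀ z ∈ p1.support, z ∈ P.support := fun z hz =>
    P.support_takeUntil_subset_support hq (by simpa [p1] using hz)
  have hs2 : ∀ z ∈ p2.support, z ∈ P.support := fun z hz =>
    P.support_dropUntil_subset_support hq hz
  have hpp : ∀ z ∈ p1.support, z ∈ p2.support → z = q := by
    intro z hz hz'
    have hz1 : z ∈ (P.takeUntil q hq).support := by simpa [p1] using hz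
    by_contra hne
    have hnd := hP.support_nodup
    rw [← P.take_spec hq, Walk.support_append] at hnd
    have hz2 : z ∈ (P.dropUntil q hq).support.tail := by
      have : z ∈ (P.dropUntil q hq).support := hz'
      rw [Walk.mem_support_iff] at this
      exact this.resolve_left hne
    exact (List.nodup_append.1 hnd).2.2 z hz1 z hz2 rfl
  have hY1 : ∀ z ∈ p1.support, z ∈ Y → z = u := by
    intro z hz hzY
    by_contra hne
    refine hint z (hs1 z hz) hne ?_ hzY
    rintro rfl
    exact hqv (hpp _ hz (by simp)).symm
  have hY2 : ∀ z ∈ p2.support, z ∈ Y → z = v := by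
    intro z hz hzY
    by_contra hne
    refine hint z (hs2 z hz) ?_ hne hzY
    rintro rfl
    exact hqu (hpp _ (by simp) hz).symm
  have hvA : v ∉ A := fun h => hAB v h hvB
  have huB : u ∉ B := fun h => hAB u huA h
  refine ⟨_, ?_, RTree.node k q (fun x => bif x then u else v) (fun x => bif x then A else B)
    (fun x => match x with | true => p1 | false => p2) ?_ ?_ ?_ ?_ ?_ ?_ ?_ ?_,
    ⟨p1, by omega⟩, ⟨p2, by omega⟩⟩
  · rintro z ⟨_ | _, h | h⟩
    · exact Or.inl (hBY h)
    · exact Or.inr (hs2 z h)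
    · exact Or.inl (hAY h)
    · exact Or.inr (hs1 z h)
  · rintro (_ | _)
    · exact hB
    · exact hA
  · rintro (_ | _)
    · exact hP.dropUntil hq
    · exact (hP.takeUntil hq).reverse
  · rintro (_ | _)
    · exact hl2
    · exact hl1
  · rintro (_ | _)
    · change p2.length ≤ n; omega
    · change p1.length ≤ n; omega
  · rintro (_ | _) z hz hz'
    · exact hY2 z hz (hBY hz')
    · exact hY1 z hz (hAY hz')
  · rintro (_ | _) (_ | _) hne z hz hz'
    · exact hne rfl
    · obtain rfl := hY2 z hz (hAY hz')
      exact hvA hz'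
    · obtain rfl := hY1 z hz (hBY hz')
      exact huB hz'
    · exact hne rfl
  · rintro (_ | _) (_ | _) hne z hz hz'
    · exact hne rfl
    · exact hAB z hz' hz
    · exact hAB z hz hz'
    · exact hne rfl
  · rintro (_ | _) (_ | _) hne z hz hz'
    · exact absurd rfl hne
    · exact hpp z hz' hz
    · exact hpp z hz hz'
    · exact absurd rfl hne

/-- The key lemma: if no subgraph of `G` is an `(ℓ-1)`-subdivision of `H_d`, then any
`Z ⊆ V(G)` extends to a set `Y` all of whose vertices are within distance `(d-2)(ℓ-1)` of
`Z`, such that no path of length between `2` and `ℓ` has both ends in `Y`, interior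
disjoint from `Y`, and ends at distance more than `2(d-2)(ℓ-1)` in `G[Y]`. -/
theorem key_lemma (d ℓ : ℕ) (hd : 2 ≤ d) (hℓ : 2 ≤ ℓ)
    (V : Type) [Fintype V] (G : SimpleGraph V)
    (hG : ¬ HasNSubdivision G (binTree d) (ℓ - 1)) (Z : Set V) :
    ∃ Y : Set V, Z ⊆ Y ∧
      (∀ y ∈ Y, eSetDist G {y} Z ≤ (((d - 2) * (ℓ - 1) : ℕ) : ℕ∞)) ∧
      ¬ ∃ (u v : V) (P : G.Walk u v), P.IsPath ∧ 2 ≤ P.length ∧ P.length ≤ ℓ ∧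
          u ∈ Y ∧ v ∈ Y ∧ (∀ x ∈ P.support, x ≠ u → x ≠ v → x ∉ Y) ∧
          ((2 * (d - 2) * (ℓ - 1) : ℕ) : ℕ∞) < eSetDist (inducedSG G Y) {u} {v} := by
  classical
  let Good : Set V → Prop := fun Y => Z ⊆ Y ∧ ∀ y ∈ Y, ∃ k ≤ d - 2,
    (∃ S ⊆ Y, RTree G (ℓ - 1) k y S) ∧ ∃ b ∈ Z, ∃ w : G.Walk y b, w.length ≤ k * (ℓ - 1)
  have hZ : Good Z := ⟨subset_rfl, fun y hy => ⟨0, by omega,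
    ⟨{y}, by simpa using hy, RTree.leaf y⟩, y, hy, Walk.nil, by simp⟩⟩
  obtain ⟨Y, -, hY⟩ := Finite.exists_le_maximal hZ
  obtain ⟨hZY, hYk⟩ := hY.prop
  refine ⟨Y, hZY, ?_, ?_⟩
  · intro y hy
    obtain ⟨k, hk, -, b, hb, w, hw⟩ := hYk y hy
    exact eSetDist_le w (Set.mem_singleton _) hb (hw.trans (Nat.mul_le_mul_right _ hk))
  · rintro ⟨u, v, P, hP, h2, hPl, hu, hv, hint, hdist⟩
    -- the interior is nonempty
    have hx : ∃ x ∈ P.support, x ∉ Y := by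
      refine ⟨P.getVert 1, P.getVert_mem_support 1, ?_⟩
      apply hint _ (P.getVert_mem_support 1)
      · intro h
        have := hP.getVert_injOn (by simp; omega) (by simp) (h.trans P.getVert_zero.symm)
        omega
      · intro h
        have := hP.getVert_injOn (by simp; omega) (by simp) (h.trans P.getVert_length.symm)
        omega
    obtain ⟨x, hxP, hxY⟩ := hx
    obtain ⟨ku, hku, ⟨Su, hSu, hTu⟩, bu, hbu, wu, hwu⟩ := hYk u hu
    obtain ⟨kv, hkv, ⟨Sv, hSv, hTv⟩, bv, hbv, wv, hwv⟩ := hYk v hv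
    obtain ⟨A, hA, hTA⟩ := hTu.trunc (min_le_left ku kv)
    obtain ⟨B, hB, hTB⟩ := hTv.trunc (min_le_right ku kv)
    have hAB : ∀ z ∈ A, z ∉ B := by
      intro z hzA hzB
      obtain ⟨w1, hw1⟩ := hTA.radius (hA.trans hSu) z hzA
      obtain ⟨w2, hw2⟩ := hTB.radius (hB.trans hSv) z hzB
      refine absurd hdist (not_lt.2 (eSetDist_le (w1.append w2.reverse) (Set.mem_singleton _)
        (Set.mem_singleton _) ?_))
      have h3 : min ku kv * (ℓ - 1) ≤ (d - 2) * (ℓ - 1) :=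
        Nat.mul_le_mul_right _ ((min_le_left _ _).trans hku)
      rw [Walk.length_append, Walk.length_reverse, mul_assoc]
      omega
    have step := fun q (hq : q ∈ P.support) (hqY : q ∉ Y) =>
      hTA.step hTB (hA.trans hSu) (hB.trans hSv) hAB P hP (by omega) hint hq hqY
    have hk : min ku kv + 1 ≤ d - 2 := by
      by_contra hcon
      have he : min ku kv + 1 = d - 1 := by omega
      obtain ⟨S, -, hT, -⟩ := step x hxP hxY
      rw [he] at hT
      exact hG (hT.hasNSubdivision (by omega))
    have hgood : Good (Y ∪ {z | z ∈ P.support}) := by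
      refine ⟨hZY.trans Set.subset_union_left, fun y hy => ?_⟩
      by_cases hyY : y ∈ Y
      · obtain ⟨k, hk, ⟨S, hS, hT⟩, hb⟩ := hYk y hyY
        exact ⟨k, hk, ⟨S, hS.trans Set.subset_union_left, hT⟩, hb⟩
      · obtain ⟨S, hS, hT, ⟨w1, hw1⟩, ⟨w2, hw2⟩⟩ := step y (hy.resolve_left hyY) hyY
        refine ⟨_, hk, ⟨S, hS, hT⟩, ?_⟩
        rcases le_total ku kv with h | h
        · refine ⟨bu, hbu, w1.append wu, ?_⟩
          rw [Walk.length_append, min_eq_left h, add_mul]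
          omega
        · refine ⟨bv, hbv, w2.append wv, ?_⟩
          rw [Walk.length_append, min_eq_right h, add_mul]
          omega
    exact hxY (hY.le_of_ge hgood Set.subset_union_left (Or.inr hxP))
end

section
/- Let G be a finite simple graph, let S, T ⊆ V(G) be disjoint, and let 𝒫 = {P_1, …, P_k} be a set of k pairwise vertex-disjoint S–T paths with V𝒫 ∪ S ∪ T = V(G), such that for each h, no proper subpath of P_h is an S–T path. Let P_h have ends s_h ∈ S and t_h ∈ T. Then the following four statements are equivalent: (1) for every choice of v_i ∈ V(P_i) for 1 ≤ i ≤ k, there is an edge ab of G with a, b ∉ {v_1, …, v_k} such that (either a ∈ S \ V𝒫, or a ∈ V(P_h) for some h and a is earlier than v_h in P_h) and (either b ∈ T \ V𝒫, or b ∈ V(P_h) for some h and b is later than v_h in P_h); (2) there is a sequence a_1b_1, …, a_nb_n of oriented edges of G not in E(P_1 ∪ ⋯ ∪ P_k) such that a_1 ∈ S \ V𝒫, b_n ∈ T \ V𝒫, and for 1 ≤ i < n, b_i and a_{i+1} belong to the same path P_h and a_{i+1} is earlier than b_i in P_h; (3) there is a sequence as in (2) satisfying in addition that for 1 ≤ h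 ≤ k and 1 ≤ i < j ≤ n, if u ∈ {a_i, b_i} ∩ V(P_h) and v ∈ {a_j, b_j} ∩ V(P_h), then either u is earlier than v in P_h, or b_i = u = v = a_j, or b_i = u and a_j = v and j = i+1; (4) there are k+1 pairwise vertex-disjoint S–T paths in G. -/
open SimpleGraph

/-- The data of Menger's augmenting-path theorem: a graph `G`, disjoint sets `S, T`, and
`k` pairwise vertex-disjoint `S`–`T` paths `P 0, …, P (k-1)` covering all of `V(G)`
together with `S ∪ T`, such that no proper subpath of any `P h` is an `S`–`T` path. -/
structure MengerData (V : Type) [DecidableEq V] (k : ℕ) where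
  G : SimpleGraph V
  S : Set V
  T : Set V
  disjST : Disjoint S T
  sv : Fin k → V
  tv : Fin k → V
  P : ∀ h : Fin k, G.Walk (sv h) (tv h)
  sv_mem : ∀ h, sv h ∈ S
  tv_mem : ∀ h, tv h ∈ T
  isPath : ∀ h, (P h).IsPath
  disjP : ∀ h h' : Fin k, h ≠ h' → ∀ x : V, x ∈ (P h).support → x ∉ (P h').support
  cover : ∀ x : V, (∃ h, x ∈ (P h).support) ∨ x ∈ S ∨ x ∈ T
  /-- no proper subpath of `P h` is an `S`–`T` path -/
  noProper : ∀ h : Fin k, ∀ u ∈ (P h).support, ∀ v ∈ (P h).support,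
    (P h).support.idxOf u ≤ (P h).support.idxOf v →
    u ∈ S → v ∈ T → u = sv h ∧ v = tv h

namespace MengerData

variable {V : Type} [DecidableEq V] {k : ℕ} (M : MengerData V k)

/-- `V𝒫`, the set of vertices of the paths. -/
def VP : Set V := {x | ∃ h : Fin k, x ∈ (M.P h).support}

/-- The position of a vertex along `P h`; `u` is earlier than `v` in `P h` iff both lie on
`P h` and `idx h u < idx h v`. -/
def idx (h : Fin k) (x : V) : ℕ := (M.P h).support.idxOf x

/-- The union `P 0 ∪ ⋯ ∪ P (k-1)` as a graph on `V`. -/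
def UP : SimpleGraph V := ⨆ h : Fin k, ((M.P h).toSubgraph).spanningCoe

/-- Statement (1): for every choice of `v h ∈ V(P h)` there is an edge of `G` jumping it. -/
def Cond1 : Prop :=
  ∀ v : Fin k → V, (∀ h, v h ∈ (M.P h).support) →
    ∃ a b : V, M.G.Adj a b ∧ (∀ h, a ≠ v h) ∧ (∀ h, b ≠ v h) ∧
      (a ∈ M.S \ M.VP ∨ ∃ h, a ∈ (M.P h).support ∧ M.idx h a < M.idx h (v h)) ∧
      (b ∈ M.T \ M.VP ∨ ∃ h, b ∈ (M.P h).support ∧ M.idx h (v h) < M.idx h b)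

/-- An augmenting sequence of oriented edges of `G` not in `E(P 0 ∪ ⋯ ∪ P (k-1))`. -/
def AugSeq {n : ℕ} (ab : Fin n → V × V) : Prop :=
  ∃ hn : 0 < n,
    (∀ i, M.G.Adj (ab i).1 (ab i).2 ∧ ¬ M.UP.Adj (ab i).1 (ab i).2) ∧
    (ab ⟨0, hn⟩).1 ∈ M.S \ M.VP ∧
    (ab ⟨n - 1, Nat.sub_lt hn Nat.one_pos⟩).2 ∈ M.T \ M.VP ∧
    ∀ (i : ℕ) (hi : i + 1 < n), ∃ h : Fin k,
      (ab ⟨i, Nat.lt_of_succ_lt hi⟩).2 ∈ (M.P h).support ∧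
      (ab ⟨i + 1, hi⟩).1 ∈ (M.P h).support ∧
      M.idx h (ab ⟨i + 1, hi⟩).1 < M.idx h (ab ⟨i, Nat.lt_of_succ_lt hi⟩).2

/-- Statement (2): there is an augmenting sequence. -/
def Cond2 : Prop := ∃ (n : ℕ) (ab : Fin n → V × V), M.AugSeq ab

/-- Statement (3): there is an augmenting sequence which is in addition well-ordered along
each path. -/
def Cond3 : Prop :=
  ∃ (n : ℕ) (ab : Fin n → V × V), M.AugSeq ab ∧
    ∀ (h : Fin k) (i j : Fin n), i < j → ∀ u v : V,
      (u = (ab i).1 ∨ u = (ab i).2) → u ∈ (M.P h).support →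
      (v = (ab j).1 ∨ v = (ab j).2) → v ∈ (M.P h).support →
      (M.idx h u < M.idx h v ∨
       ((ab i).2 = u ∧ u = v ∧ v = (ab j).1) ∨
       ((ab i).2 = u ∧ (ab j).1 = v ∧ (j : ℕ) = (i : ℕ) + 1))

/-- Statement (4): there are `k+1` pairwise vertex-disjoint `S`–`T` paths in `G`. -/
def Cond4 : Prop :=
  ∃ (u v : Fin (k + 1) → V) (Q : ∀ i, M.G.Walk (u i) (v i)),
    (∀ i, (Q i).IsPath) ∧ (∀ i, u i ∈ M.S) ∧ (∀ i, v i ∈ M.T) ∧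
    ∀ i j, i ≠ j → ∀ x, x ∈ (Q i).support → x ∉ (Q j).support

end MengerData

namespace MengerData

section aux

variable {V : Type} [DecidableEq V] {k : ℕ} (M : MengerData V k)

theorem getVert_idx {h : Fin k} {x : V} (hx : x ∈ (M.P h).support) :
    (M.P h).getVert (M.idx h x) = x := by
  unfold idx
  have hl := List.idxOf_lt_length_of_mem hx
  rw [Walk.length_support] at hl
  rw [Walk.getVert_eq_support_getElem _ (by omega)]
  exact List.getElem_idxOf _

theorem idx_le {h : Fin k} {x : V} (hx : x ∈ (M.P h).support) :
    M.idx h x ≤ (M.P h).length := by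
  have hl := List.idxOf_lt_length_of_mem hx
  rw [Walk.length_support] at hl
  unfold idx
  omega

theorem idx_getVert {h : Fin k} {n : ℕ} (hn : n ≤ (M.P h).length) :
    M.idx h ((M.P h).getVert n) = n := by
  unfold idx
  rw [Walk.getVert_eq_support_getElem _ hn]
  exact (M.isPath h).support_nodup.idxOf_getElem n _

theorem idx_inj {h : Fin k} {x y : V} (hx : x ∈ (M.P h).support) (hy : y ∈ (M.P h).support)
    (e : M.idx h x = M.idx h y) : x = y := by
  rw [← M.getVert_idx hx, ← M.getVert_idx hy, e]

theorem idx_sv (h : Fin k) : M.idx h (M.sv h) = 0 := by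
  have := M.idx_getVert (h := h) (n := 0) (Nat.zero_le _)
  simpa using this

theorem idx_tv (h : Fin k) : M.idx h (M.tv h) = (M.P h).length := by
  have := M.idx_getVert (h := h) (n := (M.P h).length) le_rfl
  simpa using this

theorem same_path {h h' : Fin k} {x : V} (hx : x ∈ (M.P h).support)
    (hx' : x ∈ (M.P h').support) : h = h' := by
  by_contra hne
  exact M.disjP h h' hne x hx hx'

theorem eq_sv {h : Fin k} {x : V} (hx : x ∈ (M.P h).support) (hS : x ∈ M.S) : x = M.sv h := by
  refine (M.noProper h x hx (M.tv h) (Walk.end_mem_support _) ?_ hS (M.tv_mem h)).1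
  have h1 := M.idx_le hx
  have h2 := M.idx_tv h
  unfold idx at h1 h2
  omega

theorem eq_tv {h : Fin k} {x : V} (hx : x ∈ (M.P h).support) (hT : x ∈ M.T) : x = M.tv h := by
  refine (M.noProper h (M.sv h) (Walk.start_mem_support _) x hx ?_ (M.sv_mem h) hT).2
  have h2 := M.idx_sv h
  unfold idx at h2
  omega

theorem not_ST {x : V} (hS : x ∈ M.S) (hT : x ∈ M.T) : False :=
  Set.disjoint_left.mp M.disjST hS hT

theorem UP_adj {a b : V} (hab : M.UP.Adj a b) : ∃ h, a ∈ (M.P h).support ∧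
    b ∈ (M.P h).support ∧ (M.idx h a + 1 = M.idx h b ∨ M.idx h b + 1 = M.idx h a) := by
  unfold UP at hab
  rw [SimpleGraph.iSup_adj] at hab
  obtain ⟨h, hh⟩ := hab
  rw [Subgraph.spanningCoe_adj, Walk.toSubgraph_adj_iff] at hh
  obtain ⟨i, hi, hlt⟩ := hh
  have e1 := M.idx_getVert (h := h) (n := i) (by omega)
  have e2 := M.idx_getVert (h := h) (n := i + 1) (by omega)
  have m1 : (M.P h).getVert i ∈ (M.P h).support := Walk.getVert_mem_support _ _
  have m2 : (M.P h).getVert (i + 1) ∈ (M.P h).support := Walk.getVert_mem_support _ _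
  rw [Sym2.eq_iff] at hi
  rcases hi with ⟨rfl, rfl⟩ | ⟨rfl, rfl⟩
  · exact ⟨h, m1, m2, Or.inl (by omega)⟩
  · exact ⟨h, m2, m1, Or.inr (by omega)⟩

/-- `a` is earlier than `b` on some path. -/
def Link (b a : V) : Prop :=
  ∃ h : Fin k, b ∈ (M.P h).support ∧ a ∈ (M.P h).support ∧ M.idx h a < M.idx h b

/-- Partial augmenting sequence with edges `a 0 b 0, …, a m b m`. -/
def Partial (m : ℕ) (a b : ℕ → V) : Prop :=
  (∀ i ≤ m, M.G.Adj (a i) (b i) ∧ ¬ M.UP.Adj (a i) (b i)) ∧ a 0 ∈ M.S \ M.VP ∧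
    ∀ i < m, M.Link (b i) (a (i + 1))

/-- Full augmenting sequence. -/
def Full (m : ℕ) (a b : ℕ → V) : Prop := M.Partial m a b ∧ b m ∈ M.T \ M.VP

theorem augSeq_of_full {m : ℕ} {a b : ℕ → V} (h : M.Full m a b) :
    M.AugSeq (fun i : Fin (m + 1) => (a i, b i)) := by
  obtain ⟨⟨h1, h2, h3⟩, h4⟩ := h
  exact ⟨Nat.succ_pos _, fun i => h1 i (by omega), h2, h4, fun i hi => h3 i (by omega)⟩

theorem full_of_augSeq {n : ℕ} {ab : Fin n → V × V} (h : M.AugSeq ab) :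
    ∃ (m : ℕ) (e : n = m + 1), M.Full m (fun i => (ab ⟨min i m, by omega⟩).1)
      (fun i => (ab ⟨min i m, by omega⟩).2) := by
  obtain ⟨hn, h1, h2, h3, h4⟩ := h
  obtain ⟨m, rfl⟩ : ∃ m, n = m + 1 := ⟨n - 1, by omega⟩
  refine ⟨m, rfl, ⟨fun i hi => h1 _, by simpa using h2, fun i hi => ?_⟩, by simpa using h3⟩
  have := h4 i (by omega)
  have e1 : min i m = i := by omega
  have e2 : min (i + 1) m = i + 1 := by omega
  simp only [e1, e2]
  exact this

theorem partial_extend {m : ℕ} {a b : ℕ → V} (h : M.Partial m a b) {x y : V}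
    (hl : M.Link (b m) x) (he : M.G.Adj x y ∧ ¬ M.UP.Adj x y) :
    ∃ a' b', M.Partial (m + 1) a' b' ∧ b' (m + 1) = y := by
  obtain ⟨h1, h2, h3⟩ := h
  refine ⟨fun i => if i ≤ m then a i else x, fun i => if i ≤ m then b i else y,
    ⟨fun i hi => ?_, by simpa using h2, fun i hi => ?_⟩, by simp⟩
  · by_cases c : i ≤ m
    · simpa [c] using h1 i c
    · simpa [c] using he
  · have c : i ≤ m := by omega
    by_cases c' : i + 1 ≤ m
    · simp only [c, c', if_true]
      exact h3 i (by omega)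
    · have : i = m := by omega
      subst this
      simpa using hl

theorem cond1_to_cond2 [Fintype V] (H : M.Cond1) : M.Cond2 := by
  classical
  let Re : V → Prop := fun y => ∃ m a b, M.Partial m a b ∧ b m = y
  have key : ∀ h, ∃ v ∈ (M.P h).support, (Re v ∨ v = M.sv h) ∧
      ∀ y ∈ (M.P h).support, Re y → M.idx h y ≤ M.idx h v := by
    intro h
    let F : Finset V := Finset.univ.filter fun v => v ∈ (M.P h).support ∧ (Re v ∨ v = M.sv h)
    have hF : F.Nonempty := ⟨M.sv h, by simp [F]⟩
    obtain ⟨v, hv, hmax⟩ := F.exists_max_image (M.idx h) hF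
    simp only [F, Finset.mem_filter, Finset.mem_univ, true_and] at hv hmax
    exact ⟨v, hv.1, hv.2, fun y hy hr => hmax y ⟨hy, Or.inl hr⟩⟩
  choose v hv hr hmax using key
  obtain ⟨a, b, hadj, -, -, ha, hb⟩ := H v hv
  have hUP : ¬ M.UP.Adj a b := by
    intro hu
    obtain ⟨g, ga, gb, hg⟩ := M.UP_adj hu
    rcases ha with ha | ⟨h, ha, ha'⟩
    · exact ha.2 ⟨g, ga⟩
    rcases hb with hb | ⟨h', hb, hb'⟩
    · exact hb.2 ⟨g, gb⟩
    obtain rfl := M.same_path ga ha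
    obtain rfl := M.same_path gb hb
    omega
  have hRe : Re b := by
    rcases ha with ha | ⟨h, ha, ha'⟩
    · exact ⟨0, fun _ => a, fun _ => b, ⟨fun i _ => ⟨hadj, hUP⟩, ha, fun i hi => by omega⟩, rfl⟩
    · rcases hr h with ⟨m, a1, b1, hp, e⟩ | e
      · obtain ⟨a2, b2, hp', e'⟩ := M.partial_extend hp (x := a) (y := b)
          (by rw [e]; exact ⟨h, hv h, ha, ha'⟩) ⟨hadj, hUP⟩
        exact ⟨m + 1, a2, b2, hp', e'⟩
      · rw [e, M.idx_sv] at ha'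
        omega
  rcases hb with hb | ⟨h, hb, hb'⟩
  · obtain ⟨m, a1, b1, hp, rfl⟩ := hRe
    exact ⟨m + 1, _, M.augSeq_of_full ⟨hp, hb⟩⟩
  · have := hmax h b hb hRe
    omega

theorem shortcut {m : ℕ} {a b : ℕ → V} (H : M.Full m a b) {p q : ℕ} (hpq : p + 1 < q)
    (hq : q ≤ m) (hl : M.Link (b p) (a q)) : ∃ m' < m, ∃ a' b', M.Full m' a' b' := by
  obtain ⟨⟨h1, h2, h3⟩, h4⟩ := H
  refine ⟨m - (q - p - 1), by omega, fun i => if i ≤ p then a i else a (i + (q - p - 1)),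
    fun i => if i ≤ p then b i else b (i + (q - p - 1)),
    ⟨fun i hi => ?_, by simpa using h2, fun i hi => ?_⟩, ?_⟩
  · by_cases c : i ≤ p
    · simpa [c] using h1 i (by omega)
    · simpa [c] using h1 (i + (q - p - 1)) (by omega)
  · by_cases c : i + 1 ≤ p
    · have c' : i ≤ p := by omega
      simp only [c, c', if_true]
      exact h3 i (by omega)
    · by_cases c' : i ≤ p
      · have e : i = p := by omega
        subst e
        have e : i + 1 + (q - i - 1) = q := by omega
        simp only [c, c', if_true, if_false, e]
        exact hl
      · simp only [c, c', if_false]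
        have := h3 (i + (q - p - 1)) (by omega)
        rwa [show i + (q - p - 1) + 1 = i + 1 + (q - p - 1) by omega] at this
  · have c : ¬ (m - (q - p - 1) ≤ p) := by omega
    have e : m - (q - p - 1) + (q - p - 1) = m := by omega
    simp only [c, if_false, e]
    exact h4

theorem cond2_to_cond3 (H : M.Cond2) : M.Cond3 := by
  classical
  obtain ⟨n, ab, hab⟩ := H
  obtain ⟨m0, e0, hm0⟩ := M.full_of_augSeq hab
  have hex : ∃ m, ∃ a b, M.Full m a b := ⟨m0, _, _, hm0⟩
  obtain ⟨a, b, hF⟩ := Nat.find_spec hex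
  have hmin : ∀ m' < Nat.find hex, ¬ ∃ a b, M.Full m' a b := fun m' h => Nat.find_min hex h
  generalize Nat.find hex = m at hF hmin
  have noshort : ∀ p q, p + 1 < q → q ≤ m → ¬ M.Link (b p) (a q) := by
    intro p q h1 h2 h3
    obtain ⟨m', hm', h⟩ := M.shortcut hF h1 h2 h3
    exact hmin m' hm' h
  refine ⟨m + 1, _, M.augSeq_of_full hF, ?_⟩
  obtain ⟨⟨-, h2, h3⟩, h4⟩ := hF
  have prev : ∀ i ≤ m, ∀ h, a i ∈ (M.P h).support →
      ∃ p, p + 1 = i ∧ b p ∈ (M.P h).support ∧ M.idx h (a i) < M.idx h (b p) := by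
    intro i hi h hh
    rcases i with _ | p
    · exact absurd ⟨h, hh⟩ h2.2
    · obtain ⟨g, g1, g2, g3⟩ := h3 p (by omega)
      obtain rfl := M.same_path hh g2
      exact ⟨p, rfl, g1, g3⟩
  have next : ∀ i ≤ m, ∀ h, b i ∈ (M.P h).support →
      i + 1 ≤ m ∧ a (i + 1) ∈ (M.P h).support ∧ M.idx h (a (i + 1)) < M.idx h (b i) := by
    intro i hi h hh
    rcases Nat.lt_or_ge i m with c | c
    · obtain ⟨g, g1, g2, g3⟩ := h3 i c
      obtain rfl := M.same_path hh g1
      exact ⟨c, g2, g3⟩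
    · obtain rfl : i = m := by omega
      exact absurd ⟨h, hh⟩ h4.2
  intro h i j hij u v hu hus hv hvs
  by_cases hlt : M.idx h u < M.idx h v
  · exact Or.inl hlt
  right
  have hij' : (i : ℕ) < j := hij
  have hi : (i : ℕ) ≤ m := by omega
  have hj : (j : ℕ) ≤ m := by omega
  simp only at hu hv ⊢
  rcases hu with rfl | rfl
  · exfalso
    obtain ⟨p, p1, p2, p3⟩ := prev i hi h hus
    rcases hv with rfl | rfl
    · exact noshort p j (by omega) hj ⟨h, p2, hvs, by omega⟩
    · obtain ⟨n1, n2, n3⟩ := next j hj h hvs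
      exact noshort p (j + 1) (by omega) n1 ⟨h, p2, n2, by omega⟩
  · rcases hv with rfl | rfl
    · by_cases e : M.idx h (b i) = M.idx h (a j)
      · exact Or.inl ⟨rfl, M.idx_inj hus hvs e, rfl⟩
      · refine Or.inr ⟨rfl, rfl, ?_⟩
        by_contra hne
        exact noshort i j (by omega) hj ⟨h, hus, hvs, by omega⟩
    · exfalso
      obtain ⟨n1, n2, n3⟩ := next j hj h hvs
      exact noshort i (j + 1) (by omega) n1 ⟨h, hus, n2, by omega⟩

/-- A forest with `k+1` roots in `S` all of whose leaves are in `T` gives `k+1` paths. -/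
theorem cond4_of_forest [Fintype V] (R : V → V → Prop) (u : Fin (k + 1) → V)
    (hadj : ∀ x y, R x y → M.G.Adj x y)
    (hinj : ∀ x y z, R x z → R y z → x = y)
    (hu : ∀ i x, ¬ R x (u i)) (huinj : Function.Injective u) (huS : ∀ i, u i ∈ M.S)
    (hsucc : ∀ x, x ∉ M.T → ((∃ i, x = u i) ∨ ∃ w, R w x) → ∃ y, R x y) : M.Cond4 := by
  classical
  have hreach : ∀ i, ∃ t ∈ M.T, Relation.ReflTransGen R (u i) t := by
    intro i
    by_contra hcon
    push Not at hcon
    let C := {x : V // Relation.ReflTransGen R (u i) x}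
    have hs : ∀ x : C, ∃ y : C, R x.1 y.1 := by
      rintro ⟨x, hx⟩
      have hr : (∃ i, x = u i) ∨ ∃ w, R w x := by
        rcases Relation.ReflTransGen.cases_tail hx with e | ⟨w, -, hw⟩
        · exact Or.inl ⟨i, e⟩
        · exact Or.inr ⟨w, hw⟩
      obtain ⟨y, hy⟩ := hsucc x (fun hT => hcon x hT hx) hr
      exact ⟨⟨y, hx.tail hy⟩, hy⟩
    choose g hg using hs
    have gi : Function.Injective g := by
      intro x y e
      have h1 := hg x
      rw [e] at h1
      exact Subtype.ext (hinj _ _ _ h1 (hg y))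
    obtain ⟨x, hx⟩ := (Finite.surjective_of_injective gi) ⟨u i, Relation.ReflTransGen.refl⟩
    have := hg x
    rw [hx] at this
    exact hu i _ this
  choose v hvT hv using hreach
  have huniq : ∀ i x, Relation.ReflTransGen R (u i) x → ∀ j, Relation.ReflTransGen R (u j) x →
      i = j := by
    intro i x hx
    induction hx with
    | refl =>
      intro j hj
      rcases Relation.ReflTransGen.cases_tail hj with e | ⟨w, -, hw⟩
      · exact huinj e
      · exact absurd hw (hu i w)
    | tail hb hbc ih =>
      intro j hj
      rcases Relation.ReflTransGen.cases_tail hj with e | ⟨w, hw', hw⟩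
      · subst e
        exact absurd hbc (hu j _)
      · obtain rfl := hinj _ _ _ hw hbc
        exact ih j hw'
  have hwalk : ∀ i x, Relation.ReflTransGen R (u i) x → ∃ W : M.G.Walk (u i) x,
      ∀ y ∈ W.support, Relation.ReflTransGen R (u i) y := by
    intro i x hx
    induction hx with
    | refl => exact ⟨Walk.nil, by simp [Relation.ReflTransGen.refl]⟩
    | tail hb hbc ih =>
      obtain ⟨W, hW⟩ := ih
      refine ⟨W.concat (hadj _ _ hbc), ?_⟩
      intro y hy
      rw [Walk.support_concat] at hy
      simp only [List.mem_append, List.mem_singleton] at hy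
      rcases hy with hy | rfl
      · exact hW y hy
      · exact hb.tail hbc
  choose W hW using fun i => hwalk i (v i) (hv i)
  refine ⟨u, v, fun i => (W i).bypass, fun i => Walk.bypass_isPath _, huS, hvT, ?_⟩
  intro i j hij x hx hx'
  exact hij (huniq i x (hW i x (Walk.support_bypass_subset_support _ hx)) j
    (hW j x (Walk.support_bypass_subset_support _ hx')))

theorem cond4_of_full [Fintype V] {m : ℕ} {a b : ℕ → V} (hF : M.Full m a b)
    (hord : ∀ (h : Fin k) (i j : ℕ), i < j → j ≤ m → ∀ u v : V,
      (u = a i ∨ u = b i) → u ∈ (M.P h).support →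
      (v = a j ∨ v = b j) → v ∈ (M.P h).support →
      (M.idx h u < M.idx h v ∨ (b i = u ∧ u = v ∧ v = a j) ∨
       (b i = u ∧ a j = v ∧ j = i + 1))) : M.Cond4 := by
  classical
  obtain ⟨⟨h1, h2, h3⟩, h4⟩ := hF
  have next : ∀ i ≤ m, ∀ h, b i ∈ (M.P h).support →
      i + 1 ≤ m ∧ a (i + 1) ∈ (M.P h).support ∧ M.idx h (a (i + 1)) < M.idx h (b i) := by
    intro i hi h hh
    rcases Nat.lt_or_ge i m with c | c
    · obtain ⟨g, g1, g2, g3⟩ := h3 i c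
      obtain rfl := M.same_path hh g1
      exact ⟨c, g2, g3⟩
    · obtain rfl : i = m := by omega
      exact absurd ⟨h, hh⟩ h4.2
  have bVP : ∀ i ≤ m, b i ∉ M.VP → i = m := by
    intro i hi hb
    by_contra hne
    obtain ⟨h, hh, -⟩ := h3 i (by omega)
    exact hb ⟨h, hh⟩
  have bb : ∀ h i j, i < j → j ≤ m → b i ∈ (M.P h).support → b j ∈ (M.P h).support →
      M.idx h (b i) < M.idx h (b j) := by
    intro h i j hij hj hbi hbj
    obtain ⟨n1, n2, n3⟩ := next j hj h hbj
    rcases hord h i j hij hj _ _ (Or.inr rfl) hbi (Or.inr rfl) hbj with c | c | c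
    · exact c
    · obtain ⟨-, e, e'⟩ := c
      exact absurd e' (h1 j hj).1.ne'
    · exact absurd c.2.1 (h1 j hj).1.ne
  have ba : ∀ h i j, i + 1 < j → j ≤ m → b i ∈ (M.P h).support → a j ∈ (M.P h).support →
      M.idx h (b i) ≤ M.idx h (a j) := by
    intro h i j hij hj hbi haj
    rcases hord h i j (by omega) hj _ _ (Or.inr rfl) hbi (Or.inl rfl) haj with c | c | c
    · exact c.le
    · rw [c.2.1]
    · omega
  let D : Fin k → V → Prop := fun h x => ∃ i < m, b i ∈ (M.P h).support ∧
    M.idx h (a (i + 1)) ≤ M.idx h x ∧ M.idx h x < M.idx h (b i)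
  let Old : V → V → Prop := fun x y => ∃ h, x ∈ (M.P h).support ∧ y ∈ (M.P h).support ∧
    M.idx h y = M.idx h x + 1 ∧ ¬ D h x
  let New : V → V → Prop := fun x y => ∃ i ≤ m, x = a i ∧ y = b i
  have newold : ∀ x y z, New x z → Old y z → False := by
    rintro x y z ⟨i, hi, rfl, rfl⟩ ⟨h, hy, hz, e, hD⟩
    obtain ⟨n1, n2, n3⟩ := next i hi h hz
    exact hD ⟨i, by omega, hz, by omega, by omega⟩
  refine M.cond4_of_forest (fun x y => New x y ∨ Old x y)
    (Fin.cons (a 0) M.sv) ?_ ?_ ?_ ?_ ?_ ?_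
  · rintro x y (⟨i, hi, rfl, rfl⟩ | ⟨h, hx, hy, e, -⟩)
    · exact (h1 i hi).1
    · rw [← M.getVert_idx hx, ← M.getVert_idx hy, e]
      have := M.idx_le hy
      exact (M.P h).adj_getVert_succ (by omega)
  · rintro x y z (hx | hx) (hy | hy)
    · obtain ⟨i, hi, rfl, rfl⟩ := hx
      obtain ⟨j, hj, rfl, e⟩ := hy
      by_cases c : b i ∈ M.VP
      · obtain ⟨h, hh⟩ := c
        have hh' := hh
        rw [e] at hh'
        rcases lt_trichotomy i j with c | rfl | c
        · have := bb h i j c hj hh hh'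
          rw [e] at this
          omega
        · rfl
        · have := bb h j i c hi hh' hh
          rw [e] at this
          omega
      · have e1 := bVP i hi c
        rw [e] at c
        have e2 := bVP j hj c
        rw [e1, e2]
    · exact (newold _ _ _ hx hy).elim
    · exact (newold _ _ _ hy hx).elim
    · obtain ⟨h, hx, hz, e, -⟩ := hx
      obtain ⟨h', hy, hz', e', -⟩ := hy
      obtain rfl := M.same_path hz hz'
      exact M.idx_inj hx hy (by omega)
  · intro i x
    refine Fin.cases ?_ (fun h => ?_) i
    · rw [Fin.cons_zero]
      rintro (⟨i, hi, -, e⟩ | ⟨h, -, hy, -⟩)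
      · have hb : b i ∉ M.VP := by rw [← e]; exact h2.2
        have := bVP i hi hb
        subst this
        exact M.not_ST h2.1 (e ▸ h4.1)
      · exact h2.2 ⟨h, hy⟩
    · rw [Fin.cons_succ]
      have h0 := M.idx_sv h
      rintro (⟨i, hi, -, e⟩ | ⟨h', -, hy, e, -⟩)
      · rw [e] at h0
        obtain ⟨-, -, n3⟩ := next i hi h (by rw [← e]; exact Walk.start_mem_support _)
        omega
      · obtain rfl := M.same_path hy (Walk.start_mem_support (M.P h))
        omega
  · rw [Fin.cons_injective_iff]
    refine ⟨?_, ?_⟩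
    · rintro ⟨h, hh⟩
      exact h2.2 ⟨h, hh ▸ Walk.start_mem_support _⟩
    · intro h h' e
      refine M.same_path (x := M.sv h) (Walk.start_mem_support _) ?_
      rw [e]
      exact Walk.start_mem_support _
  · intro i
    exact Fin.cases h2.1 (fun h => M.sv_mem h) i
  · intro x hxT hx
    by_cases hxa : ∃ i ≤ m, x = a i
    · obtain ⟨i, hi, rfl⟩ := hxa
      exact ⟨b i, Or.inl ⟨i, hi, rfl, rfl⟩⟩
    have hreach : ∃ h, x ∈ (M.P h).support ∧ (x = M.sv h ∨ (∃ j ≤ m, x = b j) ∨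
        ∃ w, w ∈ (M.P h).support ∧ M.idx h x = M.idx h w + 1 ∧ ¬ D h w) := by
      rcases hx with ⟨i, hi⟩ | ⟨w, ⟨i, hi, -, e⟩ | ⟨h, hw, hx, e, hD⟩⟩
      · revert hi
        refine Fin.cases (fun e => ?_) (fun h e => ?_) i
        · exact absurd ⟨0, Nat.zero_le _, by simpa using e⟩ hxa
        · rw [Fin.cons_succ] at e
          exact ⟨h, by rw [e]; exact Walk.start_mem_support _, Or.inl e⟩
      · by_cases c : b i ∈ M.VP
        · obtain ⟨h, hh⟩ := c
          exact ⟨h, e ▸ hh, Or.inr (Or.inl ⟨i, hi, e⟩)⟩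
        · have := bVP i hi c
          subst this
          exact absurd (e ▸ h4.1) hxT
      · exact ⟨h, hx, Or.inr (Or.inr ⟨w, hw, e, hD⟩)⟩
    obtain ⟨h, hxh, hr⟩ := hreach
    have hnD : ¬ D h x := by
      rintro ⟨i, hi, hb, l1, l2⟩
      obtain ⟨n1, n2, n3⟩ := next i hi.le h hb
      have hne : M.idx h (a (i + 1)) ≠ M.idx h x := fun e =>
        hxa ⟨i + 1, n1, (M.idx_inj n2 hxh e).symm⟩
      rcases hr with e | ⟨j, hj, e⟩ | ⟨w, hw, e, hD⟩
      · rw [e, M.idx_sv] at l1 hne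
        omega
      · rw [e] at hxh l1 l2 hne
        rcases lt_trichotomy i j with c | rfl | c
        · have := bb h i j c hj hb hxh
          omega
        · omega
        · have := ba h j (i + 1) (by omega) n1 hxh n2
          omega
      · exact hD ⟨i, hi, hb, by omega, by omega⟩
    have hlt : M.idx h x < (M.P h).length := by
      have := M.idx_le hxh
      rcases this.lt_or_eq with c | c
      · exact c
      · rw [← M.idx_tv] at c
        have := M.idx_inj hxh (Walk.end_mem_support _) c
        exact absurd (this ▸ M.tv_mem h) hxT
    exact ⟨(M.P h).getVert (M.idx h x + 1), Or.inr ⟨h, hxh, Walk.getVert_mem_support _ _,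
      M.idx_getVert hlt, hnD⟩⟩

theorem cond3_to_cond4 [Fintype V] (H : M.Cond3) : M.Cond4 := by
  obtain ⟨n, ab, hab, hord⟩ := H
  obtain ⟨m, rfl, hF⟩ := M.full_of_augSeq hab
  refine M.cond4_of_full hF ?_
  intro h i j hij hj u v h1 h2 h3 h4
  have e1 : min i m = i := by omega
  have e2 : min j m = j := by omega
  have := hord h ⟨min i m, by omega⟩ ⟨min j m, by omega⟩
    (by rw [Fin.lt_def]; simp only; omega) u v h1 h2 h3 h4
  simpa only [e1, e2] using this

theorem cond4_to_cond1 (H : M.Cond4) : M.Cond1 := by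
  classical
  obtain ⟨u, v, Q, -, hu, hv, hd⟩ := H
  intro w hw
  have hav : ∃ i, ∀ h, w h ∉ (Q i).support := by
    by_contra hcon
    push Not at hcon
    choose f hf using hcon
    obtain ⟨i, j, hij, e⟩ := Fintype.exists_ne_map_eq_of_card_lt f (by simp)
    have h1 := hf j
    rw [← e] at h1
    exact hd i j hij _ (hf i) h1
  obtain ⟨i, hi⟩ := hav
  let A : Set V := {a | a ∈ M.S \ M.VP ∨ ∃ h, a ∈ (M.P h).support ∧ M.idx h a < M.idx h (w h)}
  have huw : ∀ h, u i ≠ w h := fun h e => hi h (e ▸ Walk.start_mem_support _)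
  have hvw : ∀ h, v i ≠ w h := fun h e => hi h (e ▸ Walk.end_mem_support _)
  have huA : u i ∈ A := by
    by_cases c : u i ∈ M.VP
    · obtain ⟨h, hh⟩ := c
      refine Or.inr ⟨h, hh, ?_⟩
      have e := M.eq_sv hh (hu i)
      have h0 := M.idx_sv h
      rw [← e] at h0
      have : M.idx h (u i) ≠ M.idx h (w h) := fun e => huw h (M.idx_inj hh (hw h) e)
      omega
    · exact Or.inl ⟨hu i, c⟩
  have hvA : v i ∉ A := by
    rintro (c | ⟨h, hh, hlt⟩)
    · exact M.not_ST c.1 (hv i)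
    · have e := M.eq_tv hh (hv i)
      have h0 := M.idx_tv h
      rw [e] at hlt
      have := M.idx_le (hw h)
      omega
  obtain ⟨d, hd1, hd2, hd3⟩ := (Q i).exists_boundary_dart A huA hvA
  have m1 := (Q i).dart_fst_mem_support_of_mem_darts hd1
  have m2 := (Q i).dart_snd_mem_support_of_mem_darts hd1
  have ne2 : ∀ h, d.snd ≠ w h := fun h e => hi h (e ▸ m2)
  refine ⟨d.fst, d.snd, d.adj, fun h e => hi h (e ▸ m1), ne2, hd2, ?_⟩
  by_cases c : d.snd ∈ M.VP
  · obtain ⟨h, hh⟩ := c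
    refine Or.inr ⟨h, hh, ?_⟩
    have n1 : ¬ M.idx h d.snd < M.idx h (w h) := fun hlt => hd3 (Or.inr ⟨h, hh, hlt⟩)
    have n2 : M.idx h d.snd ≠ M.idx h (w h) := fun e => ne2 h (M.idx_inj hh (hw h) e)
    omega
  · refine Or.inl ⟨?_, c⟩
    rcases M.cover d.snd with h | h | h
    · exact absurd h c
    · exact absurd (Or.inl ⟨h, c⟩) hd3
    · exact h

end aux

end MengerData

/-- The augmenting-path theorem: the four statements are equivalent. -/
theorem menger_augmenting_tfae (V : Type) [Fintype V] [DecidableEq V] (k : ℕ)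
    (M : MengerData V k) :
    List.TFAE [M.Cond1, M.Cond2, M.Cond3, M.Cond4] := by
  tfae_have 1 → 2 := M.cond1_to_cond2
  tfae_have 2 → 3 := M.cond2_to_cond3
  tfae_have 3 → 4 := M.cond3_to_cond4
  tfae_have 4 → 1 := M.cond4_to_cond1
  tfae_finish
end

section
/- Let (S, T, 𝒫) be a setting with 𝒫 = {P_1, …, P_k}, let c ≥ 0 be an integer, and let F ⊆ F_0. Then F is c-jumping if and only if there is a c-augmenting sequence of elements of F. -/
open SimpleGraph

/-- A *setting* `(S, T, 𝒫)`: a graph `G`, disjoint sets `S, T` of vertices, and a family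
`𝒫 = {P 0, …, P (k-1)}` of `k` pairwise vertex-disjoint `S`–`T` paths, each with no
internal vertex in `S ∪ T`. -/
structure Setting (V : Type) [DecidableEq V] (k : ℕ) where
  G : SimpleGraph V
  S : Set V
  T : Set V
  disjST : Disjoint S T
  sv : Fin k → V
  tv : Fin k → V
  P : ∀ h : Fin k, G.Walk (sv h) (tv h)
  sv_mem : ∀ h, sv h ∈ S
  tv_mem : ∀ h, tv h ∈ T
  isPath : ∀ h, (P h).IsPath
  disjP : ∀ h h' : Fin k, h ≠ h' → ∀ x : V, x ∈ (P h).support → x ∉ (P h').support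
  internal : ∀ h : Fin k, ∀ x ∈ (P h).support, x ∈ S ∪ T → x = sv h ∨ x = tv h

namespace Setting

variable {V : Type} [DecidableEq V] {k : ℕ} (M : Setting V k)

/-- `V𝒫`, the set of vertices of the paths of the setting. -/
def VP : Set V := {x | ∃ h : Fin k, x ∈ (M.P h).support}

/-- `F₀`: ordered pairs of distinct vertices of `V𝒫 ∪ S ∪ T`. -/
def F0 : Set (V × V) :=
  {p | p.1 ≠ p.2 ∧ p.1 ∈ M.VP ∪ M.S ∪ M.T ∧ p.2 ∈ M.VP ∪ M.S ∪ M.T}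

/-- The position of a vertex along the path `P h` (used to express "earlier/later":
`u` is earlier than `v` in `P h` iff both lie on `P h` and `idx h u < idx h v`;
the subpath of `P h` between `u` and `v` has length `idx h v - idx h u`). -/
def idx (h : Fin k) (x : V) : ℕ := (M.P h).support.idxOf x

/-- A `c`-barrier, described by the two ends `α h`, `β h` of each subpath `Q h` of `P h`:
each `Q h` has length `idx h (β h) - idx h (α h) ≤ c`. -/
def IsBarrier (c : ℕ) (α β : Fin k → V) : Prop :=
  ∀ h : Fin k, α h ∈ (M.P h).support ∧ β h ∈ (M.P h).support ∧
    M.idx h (α h) ≤ M.idx h (β h) ∧ M.idx h (β h) - M.idx h (α h) ≤ c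

/-- Membership in the vertex set `V(Q 0 ∪ ⋯ ∪ Q (k-1))` of a barrier. -/
def InBarrier (α β : Fin k → V) (x : V) : Prop :=
  ∃ h : Fin k, x ∈ (M.P h).support ∧ M.idx h (α h) ≤ M.idx h x ∧ M.idx h x ≤ M.idx h (β h)

/-- The pair `p = (a, b)` jumps the barrier `(α, β)`. -/
def Jumps (α β : Fin k → V) (p : V × V) : Prop :=
  ¬ M.InBarrier α β p.1 ∧ ¬ M.InBarrier α β p.2 ∧
  (p.1 ∈ M.S \ M.VP ∨ ∃ h : Fin k, p.1 ∈ (M.P h).support ∧ M.idx h p.1 < M.idx h (α h)) ∧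
  (p.2 ∈ M.T \ M.VP ∨ ∃ h : Fin k, p.2 ∈ (M.P h).support ∧ M.idx h (β h) < M.idx h p.2)

/-- `F` is `c`-jumping: every `c`-barrier is jumped by some member of `F`. -/
def Jumping (c : ℕ) (F : Set (V × V)) : Prop :=
  ∀ α β : Fin k → V, M.IsBarrier c α β → ∃ p ∈ F, M.Jumps α β p

/-- `ab 0, …, ab (n-1)` is a `c`-augmenting sequence. -/
def IsAugSeq (c : ℕ) {n : ℕ} (ab : Fin n → V × V) : Prop :=
  ∃ hn : 0 < n,
    (∀ i, ab i ∈ M.F0) ∧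
    (ab ⟨0, hn⟩).1 ∈ M.S \ M.VP ∧
    (ab ⟨n - 1, Nat.sub_lt hn Nat.one_pos⟩).2 ∈ M.T \ M.VP ∧
    ∀ (i : ℕ) (hi : i + 1 < n), ∃ h : Fin k,
      (ab ⟨i, Nat.lt_of_succ_lt hi⟩).2 ∈ (M.P h).support ∧
      (ab ⟨i + 1, hi⟩).1 ∈ (M.P h).support ∧
      M.idx h (ab ⟨i + 1, hi⟩).1 < M.idx h (ab ⟨i, Nat.lt_of_succ_lt hi⟩).2 ∧
      c + 1 ≤ M.idx h (ab ⟨i, Nat.lt_of_succ_lt hi⟩).2 - M.idx h (ab ⟨i + 1, hi⟩).1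

/-- `U𝒫`, the union `P 0 ∪ ⋯ ∪ P (k-1)` as a graph on `V`. -/
def UP : SimpleGraph V := ⨆ h : Fin k, ((M.P h).toSubgraph).spanningCoe

open Classical in
/-- `dist_{U𝒫}(u, v)`: the distance between `u` and `v` in `U𝒫`, taken to be `⊤` if `u`
or `v` is not in `V𝒫` or they lie in different components of `U𝒫`. -/
noncomputable def pdist (u v : V) : ℕ∞ :=
  if u ∈ M.VP ∧ v ∈ M.VP then eSetDist M.UP {u} {v} else ⊤

/-- `D` is `ℓ`-separated. -/
def Separated (ℓ : ℕ) (D : Set (V × V)) : Prop :=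
  ∀ p ∈ D, ∀ q ∈ D, p ≠ q →
    (ℓ : ℕ∞) < M.pdist p.1 q.1 ∧ (ℓ : ℕ∞) < M.pdist p.2 q.2

end Setting


namespace Setting

variable {V : Type} [DecidableEq V] {k : ℕ} (M : Setting V k)

/-- `q` may directly follow `p` in an augmenting sequence. -/
def Link (c : ℕ) (p q : V × V) : Prop :=
  ∃ h : Fin k, p.2 ∈ (M.P h).support ∧ q.1 ∈ (M.P h).support ∧
    M.idx h q.1 < M.idx h p.2 ∧ c + 1 ≤ M.idx h p.2 - M.idx h q.1

/-- `p` is the last pair of a partial augmenting sequence in `F`. -/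
inductive Reach (c : ℕ) (F : Set (V × V)) : V × V → Prop
  | base (p : V × V) : p ∈ F → p.1 ∈ M.S \ M.VP → Reach c F p
  | step (p q : V × V) : Reach c F p → q ∈ F → M.Link c p q → Reach c F q

theorem Reach.seq {c : ℕ} {F : Set (V × V)} {p : V × V} (hp : M.Reach c F p) :
    ∃ (n : ℕ) (ab : ℕ → V × V), (ab 0).1 ∈ M.S \ M.VP ∧ ab n = p ∧ (∀ i ≤ n, ab i ∈ F) ∧
      ∀ i < n, M.Link c (ab i) (ab (i + 1)) := by
  induction hp with
  | base p hF hS => exact ⟨0, fun _ => p, hS, rfl, fun _ _ => hF, fun i hi => by omega⟩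
  | step p q _ hq hl ih =>
    obtain ⟨n, ab, h0, hn, hF, hL⟩ := ih
    refine ⟨n + 1, fun i => if i ≤ n then ab i else q, by simpa using h0, by simp, ?_, ?_⟩
    · intro i _
      by_cases h : i ≤ n
      · simpa [h] using hF i h
      · simpa [h] using hq
    · intro i hi
      rcases Nat.lt_or_ge i n with h | h
      · have h1 : i ≤ n := by omega
        have h2 : i + 1 ≤ n := by omega
        simpa [h1, h2] using hL i h
      · have h1 : i = n := by omega
        subst h1
        simpa [hn] using hl

theorem path_unique {h h' : Fin k} {x : V} (hx : x ∈ (M.P h).support)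
    (hx' : x ∈ (M.P h').support) : h = h' := by
  by_contra hne
  exact M.disjP h h' hne x hx hx'

theorem exists_idx (h : Fin k) (m : ℕ) (hm : m < (M.P h).support.length) :
    ∃ x ∈ (M.P h).support, M.idx h x = m :=
  ⟨(M.P h).support[m], List.getElem_mem hm, (M.isPath h).support_nodup.idxOf_getElem m hm⟩

theorem exists_max [Fintype V] (R : V → Prop) (h : Fin k) :
    ∃ m < (M.P h).support.length, (∀ x ∈ (M.P h).support, R x → M.idx h x ≤ m) ∧
      (m = 0 ∨ ∃ x ∈ (M.P h).support, R x ∧ M.idx h x = m) := by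
  classical
  by_cases hne : ∃ x ∈ (M.P h).support, R x
  · obtain ⟨x, ⟨hx, hR⟩, hmax⟩ := Set.exists_max_image {x | x ∈ (M.P h).support ∧ R x}
      (M.idx h) (Set.toFinite _) hne
    exact ⟨M.idx h x, List.idxOf_lt_length_of_mem hx, fun y hy hRy => hmax y ⟨hy, hRy⟩,
      Or.inr ⟨x, hx, hR, rfl⟩⟩
  · exact ⟨0, by simp, fun x hx hR => absurd ⟨x, hx, hR⟩ hne, Or.inl rfl⟩

end Setting

/-- `F` is `c`-jumping iff there is a `c`-augmenting sequence of elements of `F`. -/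
theorem jumping_iff_augSeq (V : Type) [Fintype V] [DecidableEq V] (k : ℕ)
    (M : Setting V k) (c : ℕ) (F : Set (V × V)) (hF : F ⊆ M.F0) :
    M.Jumping c F ↔
      ∃ (n : ℕ) (ab : Fin n → V × V), M.IsAugSeq c ab ∧ ∀ i, ab i ∈ F := by
  constructor
  · intro hJ
    suffices hR : ∃ p, M.Reach c F p ∧ p.2 ∈ M.T \ M.VP by
      obtain ⟨p, hp, hT⟩ := hR
      obtain ⟨n, ab, h0, hn, hFn, hL⟩ := hp.seq
      refine ⟨n + 1, fun i => ab i, ⟨Nat.succ_pos n, fun i => hF (hFn i (by omega)), h0, ?_, ?_⟩,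
        fun i => hFn i (by omega)⟩
      · simpa [hn] using hT
      · intro i hi
        exact hL i (by omega)
    choose m hm hmax hatt using fun h => M.exists_max (fun x => ∃ p, M.Reach c F p ∧ p.2 = x) h
    choose β hβ hβi using fun h => M.exists_idx h (m h) (hm h)
    choose α hα hαi using fun h => M.exists_idx h (m h - c) (by have := hm h; omega)
    obtain ⟨p, hpF, -, -, h1, h2⟩ := hJ α β (fun h => ⟨hα h, hβ h, by
      rw [hαi, hβi]; omega, by rw [hαi, hβi]; omega⟩)
    have hp : M.Reach c F p := by
      rcases h1 with h1 | ⟨h, hh, hlt⟩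
      · exact .base p hpF h1
      · rw [hαi] at hlt
        rcases hatt h with h0 | ⟨x, hx, ⟨q, hq, rfl⟩, hxi⟩
        · omega
        · exact .step q p hq hpF ⟨h, hx, hh, by omega, by omega⟩
    rcases h2 with h2 | ⟨h, hh, hlt⟩
    · exact ⟨p, hp, h2⟩
    · have := hmax h p.2 hh ⟨p, hp, rfl⟩
      rw [hβi] at hlt
      omega
  · rintro ⟨n, ab, ⟨hn, -, h0, hlast, hL⟩, hFn⟩ α β hB
    classical
    have hright : ∃ i, ∃ hi : i < n, (ab ⟨i, hi⟩).2 ∈ M.T \ M.VP ∨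
        ∃ h : Fin k, (ab ⟨i, hi⟩).2 ∈ (M.P h).support ∧
          M.idx h (β h) < M.idx h (ab ⟨i, hi⟩).2 := ⟨n - 1, by omega, Or.inl hlast⟩
    obtain ⟨hi, hr⟩ := Nat.find_spec hright
    have hmin := fun j => Nat.find_min hright (m := j)
    generalize Nat.find hright = i at hi hr hmin
    have hleft : (ab ⟨i, hi⟩).1 ∈ M.S \ M.VP ∨
        ∃ h : Fin k, (ab ⟨i, hi⟩).1 ∈ (M.P h).support ∧
          M.idx h (ab ⟨i, hi⟩).1 < M.idx h (α h) := by
      cases i with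
      | zero => exact Or.inl h0
      | succ j =>
        obtain ⟨h, hb, ha, hlt, hc⟩ := hL j hi
        right
        refine ⟨h, ha, ?_⟩
        have hnr : ¬ M.idx h (β h) < M.idx h (ab ⟨j, Nat.lt_of_succ_lt hi⟩).2 := fun hlt' =>
          hmin j (by omega) ⟨by omega, Or.inr ⟨h, hb, hlt'⟩⟩
        have := (hB h).2.2
        omega
    refine ⟨_, hFn ⟨i, hi⟩, ?_, ?_, hleft, hr⟩
    · rintro ⟨h', hm', h1, h2⟩
      rcases hleft with hl | ⟨h, hh, hlt⟩
      · exact hl.2 ⟨h', hm'⟩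
      · obtain rfl := M.path_unique hh hm'
        omega
    · rintro ⟨h', hm', h1, h2⟩
      rcases hr with hl | ⟨h, hh, hlt⟩
      · exact hl.2 ⟨h', hm'⟩
      · obtain rfl := M.path_unique hh hm'
        omega
end

section
/- Let (S, T, 𝒫) be a setting with 𝒫 = {P_1, …, P_k}, let c ≥ 0 be an integer, let F ⊆ F_0 be c-jumping, and choose a c-augmenting sequence a_1b_1, …, a_nb_n of elements of F with n minimum. Then for 1 ≤ h ≤ k and 1 ≤ i < j ≤ n, if u ∈ {a_i, b_i} ∩ V(P_h) and v ∈ {a_j, b_j} ∩ V(P_h), then either (i) u is earlier than v in P_h, or (ii) b_i = u and v = a_j and the subpath of P_h between u and v has length at most c, or (iii) b_i = u and v = a_j and j = i+1. -/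
open SimpleGraph

/-- A sequence of minimum length admits no shortcut from `b p` to `a q` with `p + 1 < q`. -/
theorem augSeq_no_shortcut {V : Type} [DecidableEq V] {k : ℕ}
    (M : Setting V k) (c : ℕ) (F : Set (V × V))
    (n : ℕ) (ab : Fin n → V × V) (hab : M.IsAugSeq c ab) (habF : ∀ i, ab i ∈ F)
    (hmin : ∀ (m : ℕ) (ab' : Fin m → V × V),
      M.IsAugSeq c ab' → (∀ i, ab' i ∈ F) → n ≤ m)
    (h : Fin k) (p q : ℕ) (hp : p < n) (hq : q < n) (hpq : p + 1 < q)
    (hb : (ab ⟨p, hp⟩).2 ∈ (M.P h).support) (ha : (ab ⟨q, hq⟩).1 ∈ (M.P h).support)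
    (hlen : M.idx h (ab ⟨q, hq⟩).1 + (c + 1) ≤ M.idx h (ab ⟨p, hp⟩).2) : False := by
  obtain ⟨hn, h0, hS, hT, hstep⟩ := hab
  obtain ⟨d, rfl⟩ : ∃ d, q = p + 1 + d := ⟨q - (p + 1), by omega⟩
  have hr : ∀ t : Fin (n - d), (if (t : ℕ) ≤ p then (t : ℕ) else t + d) < n := by
    intro t
    have := t.2
    split_ifs <;> omega
  have key := hmin (n - d) (fun t => ab ⟨_, hr t⟩) ?_ (fun _ => habF _)
  · omega
  · refine ⟨by omega, fun _ => h0 _, ?_, ?_, ?_⟩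
    · simpa using hS
    · have e : (if n - d - 1 ≤ p then n - d - 1 else n - d - 1 + d) = n - 1 := by
        split_ifs <;> omega
      simp only [e]
      exact hT
    · intro i hi
      by_cases h1 : i + 1 ≤ p
      · have e1 : i ≤ p := by omega
        simpa [h1, e1] using hstep i (by omega)
      · by_cases h2 : i = p
        · subst h2
          refine ⟨h, ?_⟩
          simp only [le_refl, if_true, h1, if_false]
          exact ⟨hb, ha, by omega, by omega⟩
        · have e1 : ¬ i ≤ p := by omega
          have e2 : i + 1 + d = i + d + 1 := by omega
          simp only [h1, e1, if_false, e2]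
          exact hstep (i + d) (by omega)

/-- Properties of a minimum-length `c`-augmenting sequence in a `c`-jumping set `F`. -/
theorem minimal_augSeq (V : Type) [Fintype V] [DecidableEq V] (k : ℕ)
    (M : Setting V k) (c : ℕ) (F : Set (V × V)) (hF : F ⊆ M.F0)
    (hjump : M.Jumping c F)
    (n : ℕ) (ab : Fin n → V × V) (hab : M.IsAugSeq c ab) (habF : ∀ i, ab i ∈ F)
    (hmin : ∀ (m : ℕ) (ab' : Fin m → V × V),
      M.IsAugSeq c ab' → (∀ i, ab' i ∈ F) → n ≤ m) :
    ∀ (h : Fin k) (i j : Fin n), i < j → ∀ u v : V,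
      (u = (ab i).1 ∨ u = (ab i).2) → u ∈ (M.P h).support →
      (v = (ab j).1 ∨ v = (ab j).2) → v ∈ (M.P h).support →
      (M.idx h u < M.idx h v ∨
       ((ab i).2 = u ∧ (ab j).1 = v ∧
        M.idx h u - M.idx h v ≤ c ∧ M.idx h v - M.idx h u ≤ c) ∨
       ((ab i).2 = u ∧ (ab j).1 = v ∧ (j : ℕ) = (i : ℕ) + 1)) := by
  intro h i j hij u v hu hus hv hvs
  have ns := augSeq_no_shortcut M c F n ab hab habF hmin h
  obtain ⟨hn, h0, hS, hT, hstep⟩ := hab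
  obtain ⟨i, hi⟩ := i
  obtain ⟨j, hj⟩ := j
  have hij' : i < j := hij
  by_cases hlt : M.idx h u < M.idx h v
  · exact Or.inl hlt
  -- the predecessor of an `a` on `P h`
  have prev : (ab ⟨i, hi⟩).1 = u → ∃ p, ∃ hp : p < n, p + 1 = i ∧
      (ab ⟨p, hp⟩).2 ∈ (M.P h).support ∧
      M.idx h u + (c + 1) ≤ M.idx h (ab ⟨p, hp⟩).2 := by
    rintro rfl
    cases i with
    | zero => exact absurd ⟨h, hus⟩ hS.2
    | succ p =>
      obtain ⟨h', hb, ha, hl, hc⟩ := hstep p hi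
      have e : h' = h := by
        by_contra hne
        exact M.disjP h' h hne _ ha hus
      subst e
      exact ⟨p, by omega, rfl, hb, by omega⟩
  have next : (ab ⟨j, hj⟩).2 = v → ∃ q, ∃ hq : q < n, q = j + 1 ∧
      (ab ⟨q, hq⟩).1 ∈ (M.P h).support ∧
      M.idx h (ab ⟨q, hq⟩).1 + (c + 1) ≤ M.idx h v := by
    rintro rfl
    by_cases hjn : j + 1 < n
    · obtain ⟨h', hb, ha, hl, hc⟩ := hstep j hjn
      have e : h' = h := by
        by_contra hne
        exact M.disjP h' h hne _ hb hvs
      subst e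
      exact ⟨j + 1, hjn, rfl, ha, by omega⟩
    · have e : j = n - 1 := by omega
      subst e
      exact absurd ⟨h, hvs⟩ hT.2
  rcases hu with hu | hu
  · obtain ⟨p, hp, hpi, hpb, hpl⟩ := prev hu.symm
    rcases hv with hv | hv
    · subst hv
      exact (ns p j hp hj (by omega) hpb hvs (by omega)).elim
    · obtain ⟨q, hq, hqj, hqa, hql⟩ := next hv.symm
      exact (ns p q hp hq (by omega) hpb hqa (by omega)).elim
  · rcases hv with hv | hv
    · by_cases hc : M.idx h u - M.idx h v ≤ c
      · exact Or.inr (Or.inl ⟨hu.symm, hv.symm, hc, by omega⟩)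
      · refine Or.inr (Or.inr ⟨hu.symm, hv.symm, ?_⟩)
        by_contra hne
        have hne' : j ≠ i + 1 := hne
        subst hu hv
        exact ns i j hi hj (by omega) hus hvs (by omega)
    · obtain ⟨q, hq, hqj, hqa, hql⟩ := next hv.symm
      subst hu
      exact (ns i q hi hq (by omega) hus hqa (by omega)).elim
end

section
/- Let (S, T, 𝒫) be a setting with 𝒫 = {P_1, …, P_k}, let p, q ≥ 0 be integers, and let F ⊆ F_0 be (p+q)-jumping. Then there exists D ⊆ F that is p-jumping, such that dist_{U𝒫}(b, b') > q for all distinct pairs ab, a'b' ∈ D. -/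
open SimpleGraph

namespace Setting

variable {V : Type} [DecidableEq V] {k : ℕ} (M : Setting V k)

theorem getVert_idx (h : Fin k) (i : ℕ) (hi : i ≤ (M.P h).length) :
    M.idx h ((M.P h).getVert i) = i := by
  unfold idx
  have hl : i < (M.P h).support.length := by
    rw [Walk.length_support]; omega
  have := (M.isPath h).support_nodup.idxOf_getElem i hl
  rwa [Walk.support_getElem_eq_getVert] at this

theorem idx_le (h : Fin k) (x : V) (hx : x ∈ (M.P h).support) :
    M.idx h x ≤ (M.P h).length := by
  unfold idx
  have := List.idxOf_lt_length_iff.2 hx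
  rw [Walk.length_support] at this; omega

theorem adj_close {u v : V} (ha : M.UP.Adj u v) : ∃ h : Fin k,
    u ∈ (M.P h).support ∧ v ∈ (M.P h).support ∧
    M.idx h u ≤ M.idx h v + 1 ∧ M.idx h v ≤ M.idx h u + 1 := by
  unfold UP at ha
  rw [SimpleGraph.iSup_adj] at ha
  obtain ⟨h, ha⟩ := ha
  rw [Subgraph.spanningCoe_adj, Walk.toSubgraph_adj_iff] at ha
  obtain ⟨i, he, hi⟩ := ha
  have h1 := M.getVert_idx h i (by omega)
  have h2 := M.getVert_idx h (i+1) (by omega)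
  have m1 := (M.P h).getVert_mem_support i
  have m2 := (M.P h).getVert_mem_support (i+1)
  refine ⟨h, ?_⟩
  rcases Sym2.eq_iff.1 he with ⟨rfl, rfl⟩ | ⟨rfl, rfl⟩
  · exact ⟨m1, m2, by omega, by omega⟩
  · exact ⟨m2, m1, by omega, by omega⟩

/-- On a common path, with positions differing by at most `q`. -/
def Close (q : ℕ) (u v : V) : Prop := ∃ h : Fin k,
    u ∈ (M.P h).support ∧ v ∈ (M.P h).support ∧
    M.idx h u ≤ M.idx h v + q ∧ M.idx h v ≤ M.idx h u + q

theorem Close.symm {q : ℕ} {u v : V} (hc : M.Close q u v) : M.Close q v u := by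
  obtain ⟨h, a, b, c, d⟩ := hc
  exact ⟨h, b, a, d, c⟩

theorem walk_close {u v : V} (w : M.UP.Walk u v) (hu : u ∈ M.VP) : M.Close w.length u v := by
  induction w with
  | nil =>
    obtain ⟨h, hu⟩ := hu
    exact ⟨h, hu, hu, by simp, by simp⟩
  | cons ha w ih =>
    obtain ⟨h, a, b, c, d⟩ := M.adj_close ha
    obtain ⟨h', a', b', c', d'⟩ := ih ⟨h, b⟩
    obtain rfl := M.path_unique b a'
    exact ⟨h, a, b', by rw [Walk.length_cons]; omega, by rw [Walk.length_cons]; omega⟩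

theorem pdist_close {q : ℕ} {u v : V} (hd : ¬ (q : ℕ∞) < M.pdist u v) : M.Close q u v := by
  unfold pdist at hd
  split_ifs at hd with hv
  · by_contra hcl
    apply hd
    have : ((q + 1 : ℕ) : ℕ∞) ≤ eSetDist M.UP {u} {v} := by
      unfold eSetDist
      refine le_sInf ?_
      rintro n ⟨a, b, w, ha, hb, rfl⟩
      obtain rfl : a = u := ha
      obtain rfl : b = v := hb
      by_contra hlt
      have hle : w.length ≤ q := by
        have := not_le.1 hlt
        have := Nat.cast_lt.1 this
        omega
      obtain ⟨h, a', b', c', d'⟩ := M.walk_close w hv.1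
      exact hcl ⟨h, a', b', by omega, by omega⟩
    refine lt_of_lt_of_le ?_ this
    exact_mod_cast Nat.lt_succ_self q
  · exact absurd (ENat.coe_lt_top q) hd

/-- The top of `e` lies more than `c` after the bottom of `f` on a common path. -/
def Step (c : ℕ) (e f : V × V) : Prop := ∃ h : Fin k,
  e.2 ∈ (M.P h).support ∧ f.1 ∈ (M.P h).support ∧ M.idx h f.1 + c + 1 ≤ M.idx h e.2

/-- `e` starts a chain of `n` steps in `F` whose final top lies in `T \ VP`. -/
def Rk (c : ℕ) (F : Set (V × V)) : ℕ → V × V → Prop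
  | 0, e => e ∈ F ∧ e.2 ∈ M.T \ M.VP
  | n + 1, e => e ∈ F ∧ ∃ f, M.Step c e f ∧ Rk c F n f

theorem Rk.mem {c : ℕ} {F : Set (V × V)} {n : ℕ} {e : V × V} (hr : M.Rk c F n e) : e ∈ F := by
  cases n <;> exact hr.1

/-- `x` lies before the barrier. -/
def Before (α : Fin k → V) (x : V) : Prop :=
  x ∈ M.S \ M.VP ∨ ∃ h : Fin k, x ∈ (M.P h).support ∧ M.idx h x < M.idx h (α h)

/-- `x` lies after the barrier. -/
def After (β : Fin k → V) (x : V) : Prop :=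
  x ∈ M.T \ M.VP ∨ ∃ h : Fin k, x ∈ (M.P h).support ∧ M.idx h (β h) < M.idx h x

theorem jumps_of {α β : Fin k → V} {e : V × V}
    (h1 : M.Before α e.1) (h2 : M.After β e.2) : M.Jumps α β e := by
  refine ⟨?_, ?_, h1, h2⟩
  · rintro ⟨h, hx, ha, hb⟩
    rcases h1 with h1 | ⟨h', hx', h1⟩
    · exact h1.2 ⟨h, hx⟩
    · obtain rfl := M.path_unique hx hx'
      omega
  · rintro ⟨h, hx, ha, hb⟩
    rcases h2 with h2 | ⟨h', hx', h2⟩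
    · exact h2.2 ⟨h, hx⟩
    · obtain rfl := M.path_unique hx hx'
      omega

/-- Any jumping set contains the start of a full chain. -/
theorem exists_start {c : ℕ} {F : Set (V × V)} (hj : M.Jumping c F) :
    ∃ e n, M.Rk c F n e ∧ e.1 ∈ M.S \ M.VP := by
  classical
  have key : ∀ h : Fin k, ∃ a b : V, a ∈ (M.P h).support ∧ b ∈ (M.P h).support ∧
      M.idx h a ≤ M.idx h b ∧ M.idx h b - M.idx h a ≤ c ∧
      (∀ e n, M.Rk c F n e → e.1 ∈ (M.P h).support → M.idx h a ≤ M.idx h e.1) ∧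
      (∀ x ∈ (M.P h).support, M.idx h b < M.idx h x →
        ∃ e n, M.Rk c F n e ∧ e.1 ∈ (M.P h).support ∧ M.idx h e.1 + c + 1 ≤ M.idx h x) := by
    intro h
    by_cases hex : ∃ i, ∃ e n, M.Rk c F n e ∧ e.1 ∈ (M.P h).support ∧ M.idx h e.1 = i
    · obtain ⟨e, n, hr, hm, hi⟩ := Nat.find_spec hex
      have hmin : ∀ e' n', M.Rk c F n' e' → e'.1 ∈ (M.P h).support →
          M.idx h e.1 ≤ M.idx h e'.1 := fun e' n' hr' hm' => by
        rw [hi]; exact Nat.find_min' hex ⟨e', n', hr', hm', rfl⟩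
      have hle := M.idx_le h e.1 hm
      have hv := M.getVert_idx h (min (M.idx h e.1 + c) (M.P h).length) (min_le_right _ _)
      refine ⟨e.1, (M.P h).getVert (min (M.idx h e.1 + c) (M.P h).length), hm,
        Walk.getVert_mem_support _ _, ?_, ?_, hmin, ?_⟩
      · rw [hv]; omega
      · rw [hv]; omega
      · intro x hx hlt
        have := M.idx_le h x hx
        rw [hv] at hlt
        exact ⟨e, n, hr, hm, by omega⟩
    · have hv := M.getVert_idx h (M.P h).length le_rfl
      refine ⟨(M.P h).getVert (M.P h).length, (M.P h).getVert (M.P h).length,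
        Walk.getVert_mem_support _ _, Walk.getVert_mem_support _ _, le_rfl, by omega, ?_, ?_⟩
      · intro e n hr hm
        exact absurd ⟨_, e, n, hr, hm, rfl⟩ hex
      · intro x hx hlt
        have := M.idx_le h x hx
        omega
  choose α β hα hβ h1 h2 h3 h4 using key
  obtain ⟨e, heF, -, -, hb, ha⟩ := hj α β (fun h => ⟨hα h, hβ h, h1 h, h2 h⟩)
  have hA : ∃ n, M.Rk c F n e := by
    rcases ha with ha | ⟨h, hm, hlt⟩
    · exact ⟨0, heF, ha⟩
    · obtain ⟨f, n, hr, hm', hs⟩ := h4 h _ hm hlt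
      exact ⟨n + 1, heF, f, ⟨h, hm, hm', hs⟩, hr⟩
  obtain ⟨n, hr⟩ := hA
  rcases hb with hb | ⟨h, hm, hlt⟩
  · exact ⟨e, n, hr, hb⟩
  · have := h3 h e n hr hm
    omega

/-- The greedy extraction. -/
theorem greedy {p q : ℕ} {F : Set (V × V)} : ∀ (n : ℕ) (e : V × V), M.Rk (p + q) F n e →
    ∃ D ⊆ F, (∀ d ∈ D, ∃ i ≤ n, M.Rk (p + q) F i d) ∧
      (∀ α β, M.IsBarrier p α β → M.Before α e.1 → ∃ d ∈ D, M.Jumps α β d) ∧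
      ∀ x ∈ D, ∀ y ∈ D, x ≠ y → ¬ M.Close q x.2 y.2 := by
  classical
  intro n
  induction n using Nat.strong_induction_on with
  | _ n ih =>
  intro e he
  have heF := he.mem
  cases n with
  | zero =>
    refine ⟨{e}, by simpa using heF, ?_, ?_, ?_⟩
    · rintro d rfl
      exact ⟨0, le_rfl, he⟩
    · intro α β _ hb
      exact ⟨e, rfl, M.jumps_of hb (Or.inl he.2)⟩
    · rintro x rfl y rfl hne
      exact absurd rfl hne
  | succ n =>
    have hex : ∃ m, ∃ f, M.Step p e f ∧ M.Rk (p + q) F m f := by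
      obtain ⟨-, f, ⟨h, a, b, hs⟩, hf⟩ := he
      exact ⟨n, f, ⟨h, a, b, by omega⟩, hf⟩
    have hmn : Nat.find hex ≤ n := by
      apply Nat.find_min'
      obtain ⟨-, f, ⟨h, a, b, hs⟩, hf⟩ := he
      exact ⟨f, ⟨h, a, b, by omega⟩, hf⟩
    obtain ⟨f, ⟨h, a, b, hs⟩, hf⟩ := Nat.find_spec hex
    obtain ⟨D, hDF, hDr, hDj, hDs⟩ := ih _ (by omega) f hf
    have hfar : ∀ d ∈ D, ¬ M.Close q e.2 d.2 := by
      rintro d hd ⟨h', a', b', c', d'⟩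
      obtain ⟨i, hi, hr⟩ := hDr d hd
      cases i with
      | zero => exact hr.2.2 ⟨h', b'⟩
      | succ i =>
        obtain ⟨-, g, ⟨h'', a'', b'', hs''⟩, hg⟩ := hr
        obtain rfl := M.path_unique b' a''
        exact Nat.find_min hex (show i < Nat.find hex by omega)
          ⟨g, ⟨h', a', b'', by omega⟩, hg⟩
    refine ⟨insert e D, Set.insert_subset heF hDF, ?_, ?_, ?_⟩
    · rintro d (rfl | hd)
      · exact ⟨n + 1, le_rfl, he⟩
      · obtain ⟨i, hi, hr⟩ := hDr d hd
        exact ⟨i, by omega, hr⟩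
    · intro α β hbar hb
      by_cases hlt : M.idx h (β h) < M.idx h e.2
      · exact ⟨e, Or.inl rfl, M.jumps_of hb (Or.inr ⟨h, a, hlt⟩)⟩
      · obtain ⟨-, -, h1, h2⟩ := hbar h
        obtain ⟨d, hd, hjd⟩ := hDj α β hbar (Or.inr ⟨h, b, by omega⟩)
        exact ⟨d, Or.inr hd, hjd⟩
    · rintro x (rfl | hx) y (rfl | hy) hne
      · exact absurd rfl hne
      · exact hfar y hy
      · exact fun hc => hfar x hx (Close.symm M hc)
      · exact hDs x hx y hy hne

end Setting

/-- From a `(p+q)`-jumping set one can extract a `p`-jumping subset whose second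
coordinates are pairwise at distance more than `q` in `U𝒫`. -/
theorem separate_tops (V : Type) [Fintype V] [DecidableEq V] (k : ℕ)
    (M : Setting V k) (p q : ℕ) (F : Set (V × V)) (hF : F ⊆ M.F0)
    (hjump : M.Jumping (p + q) F) :
    ∃ D ⊆ F, M.Jumping p D ∧
      ∀ x ∈ D, ∀ y ∈ D, x ≠ y → (q : ℕ∞) < M.pdist x.2 y.2 := by
  obtain ⟨e, n, hr, hs⟩ := M.exists_start hjump
  obtain ⟨D, hDF, -, hDj, hDs⟩ := M.greedy n e hr
  refine ⟨D, hDF, fun α β hb => hDj α β hb (Or.inl hs), ?_⟩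
  intro x hx y hy hne
  by_contra hd
  exact hDs x hx y hy hne (M.pdist_close hd)
end
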